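/- arXiv:math/0608453 — 7 statements merged into one kernel-verified Lean document; each statement's English description precedes it below -/
import Mathlib

section
/- For every finite simple graph G and every integer r ≥ 2, the spectral radius satisfies μ(G)^{r+1} ≤ (r+1)·k_{r+1}(G) + Σ_{s=2}^{r} (s−1)·k_s(G)·μ(G)^{r+1−s}. -/
open Finset

/-- The number of `k`-walks in `G`: sequences `v₁, …, v_k` of vertices of `G` such that
consecutive vertices are adjacent. -/
noncomputable def walkCount {V : Type*} [Fintype V] (G : SimpleGraph V) (k : ℕ) : ℕ :=
  Nat.card {f : Fin k → V //
    ∀ (i : ℕ) (h : i + 1 < k), G.Adj (f ⟨i, Nat.lt_of_succ_lt h⟩) (f ⟨i + 1, h⟩)}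

/-- The number of `k`-walks in `G` starting at the vertex `u`. -/
noncomputable def walkCountFrom {V : Type*} [Fintype V] (G : SimpleGraph V) (u : V) (k : ℕ) : ℕ :=
  Nat.card {f : Fin k → V //
    (∀ (h : 0 < k), f ⟨0, h⟩ = u) ∧
    ∀ (i : ℕ) (h : i + 1 < k), G.Adj (f ⟨i, Nat.lt_of_succ_lt h⟩) (f ⟨i + 1, h⟩)}

/-- The number of `s`-cliques of `G`. -/
def cliqueCount {V : Type*} [Fintype V] [DecidableEq V] (G : SimpleGraph V) [DecidableRel G.Adj]
    (s : ℕ) : ℕ :=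
  (G.cliqueFinset s).card

/-- The number of `s`-cliques of `G` containing the vertex `u`. -/
def cliqueCountOn {V : Type*} [Fintype V] [DecidableEq V] (G : SimpleGraph V) [DecidableRel G.Adj]
    (u : V) (s : ℕ) : ℕ :=
  ((G.cliqueFinset s).filter (fun t => u ∈ t)).card

lemma adjMatrix_isHermitian {V : Type*} [Fintype V] [DecidableEq V] (G : SimpleGraph V)
    [DecidableRel G.Adj] : (G.adjMatrix ℝ).IsHermitian := by
  rw [Matrix.IsHermitian, Matrix.conjTranspose_eq_transpose_of_trivial]
  exact SimpleGraph.isSymm_adjMatrix G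

/-- The largest eigenvalue (spectral radius) of the adjacency matrix of `G`. -/
noncomputable def adjSpectralRadius {V : Type*} [Fintype V] [DecidableEq V] (G : SimpleGraph V)
    [DecidableRel G.Adj] : ℝ :=
  ⨆ i, (adjMatrix_isHermitian G).eigenvalues i

section Helpers

variable {V : Type*} [Fintype V] [DecidableEq V] (G : SimpleGraph V) [DecidableRel G.Adj]

/-- total weight of all `s`-cliques -/
noncomputable def cliqueWeight (x : V → ℝ) (s : ℕ) : ℝ :=
  ∑ R ∈ G.cliqueFinset s, ∑ u ∈ R, x u

lemma cw_expand (x : V → ℝ) (μ : ℝ)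
    (h : ∀ u, μ * x u ≤ ∑ v, if G.Adj u v then x v else 0) (R : Finset V) :
    μ * ∑ u ∈ R, x u ≤ ∑ v, x v * ((R.filter (fun u => G.Adj u v)).card : ℝ) := by
  rw [Finset.mul_sum]
  refine (Finset.sum_le_sum (fun u _ => h u)).trans (le_of_eq ?_)
  rw [Finset.sum_comm]
  refine Finset.sum_congr rfl fun v _ => ?_
  rw [← Finset.sum_filter, Finset.sum_const, nsmul_eq_mul, mul_comm]

lemma cw_last (x : V → ℝ) (μ : ℝ) (hx : ∀ u, 0 ≤ x u) (h1 : ∑ u, x u = 1)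
    (h : ∀ u, μ * x u ≤ ∑ v, if G.Adj u v then x v else 0) (s : ℕ) :
    μ * cliqueWeight G x s ≤ s * cliqueCount G s := by
  unfold cliqueWeight cliqueCount
  rw [Finset.mul_sum]
  have : ∀ R ∈ G.cliqueFinset s, μ * ∑ u ∈ R, x u ≤ s := by
    intro R hR
    refine (cw_expand G x μ h R).trans ?_
    calc _ ≤ ∑ v, x v * (s : ℝ) := by
          refine Finset.sum_le_sum fun v _ => mul_le_mul_of_nonneg_left ?_ (hx v)
          have := (G.mem_cliqueFinset_iff.1 hR).card_eq
          rw [← this]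
          exact_mod_cast Finset.card_filter_le _ _
      _ = s := by rw [← Finset.sum_mul, h1, one_mul]
  refine (Finset.sum_le_sum this).trans (le_of_eq ?_)
  rw [Finset.sum_const, nsmul_eq_mul, mul_comm]

lemma cw_reindex (x : V → ℝ) (s : ℕ) :
    (∑ R ∈ G.cliqueFinset s, ∑ v, if (∀ u ∈ R, G.Adj u v) then x v else 0)
      = cliqueWeight G x (s + 1) := by
  unfold cliqueWeight
  simp_rw [← Finset.sum_filter]
  rw [Finset.sum_sigma', Finset.sum_sigma']
  refine Finset.sum_bij' (fun p _ => ⟨insert p.2 p.1, p.2⟩) (fun p _ => ⟨p.1.erase p.2, p.2⟩)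
    ?_ ?_ ?_ ?_ ?_
  · rintro ⟨R, v⟩ hp
    simp only [Finset.mem_sigma, SimpleGraph.mem_cliqueFinset_iff, Finset.mem_filter,
      Finset.mem_univ, true_and] at hp ⊢
    exact ⟨hp.1.insert fun u hu => (hp.2 u hu).symm, Finset.mem_insert_self _ _⟩
  · rintro ⟨R, v⟩ hp
    simp only [Finset.mem_sigma, SimpleGraph.mem_cliqueFinset_iff, Finset.mem_filter,
      Finset.mem_univ, true_and] at hp ⊢
    refine ⟨?_, fun u hu => ?_⟩
    · refine ⟨hp.1.isClique.subset (by simp), ?_⟩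
      rw [Finset.card_erase_of_mem hp.2, hp.1.card_eq, Nat.add_sub_cancel]
    · rw [Finset.mem_erase] at hu
      exact hp.1.isClique hu.2 hp.2 hu.1
  · rintro ⟨R, v⟩ hp
    simp only [Finset.mem_sigma, SimpleGraph.mem_cliqueFinset_iff, Finset.mem_filter,
      Finset.mem_univ, true_and] at hp
    have : v ∉ R := fun hv => (hp.2 v hv).ne rfl
    simp [Finset.erase_insert this]
  · rintro ⟨R, v⟩ hp
    simp only [Finset.mem_sigma] at hp
    simp [Finset.insert_erase hp.2]
  · rintro ⟨R, v⟩ hp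
    rfl

lemma cw_step (x : V → ℝ) (μ : ℝ) (hx : ∀ u, 0 ≤ x u) (h1 : ∑ u, x u = 1)
    (h : ∀ u, μ * x u ≤ ∑ v, if G.Adj u v then x v else 0) (s : ℕ) :
    μ * cliqueWeight G x s ≤ ((s : ℝ) - 1) * cliqueCount G s + cliqueWeight G x (s + 1) := by
  rw [← cw_reindex]
  unfold cliqueWeight cliqueCount
  rw [Finset.mul_sum]
  have : ∀ R ∈ G.cliqueFinset s, μ * ∑ u ∈ R, x u ≤
      ((s : ℝ) - 1) + ∑ v, if (∀ u ∈ R, G.Adj u v) then x v else 0 := by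
    intro R hR
    refine (cw_expand G x μ h R).trans ?_
    have e : ((s : ℝ) - 1) = ∑ v, x v * ((s : ℝ) - 1) := by
      rw [← Finset.sum_mul, h1, one_mul]
    rw [e, ← Finset.sum_add_distrib]
    refine Finset.sum_le_sum fun v _ => ?_
    have hc := (G.mem_cliqueFinset_iff.1 hR).card_eq
    split_ifs with hv
    · have h2 : ((R.filter (fun u => G.Adj u v)).card : ℝ) ≤ s := by
        rw [← hc]; exact_mod_cast Finset.card_filter_le _ _
      nlinarith [hx v]
    · have h2 : (R.filter (fun u => G.Adj u v)).card < R.card := by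
        push Not at hv
        obtain ⟨u, hu, huv⟩ := hv
        exact Finset.card_lt_card (Finset.filter_ssubset.2 ⟨u, hu, huv⟩)
      have h3 : ((R.filter (fun u => G.Adj u v)).card : ℝ) + 1 ≤ s := by
        rw [← hc]; exact_mod_cast h2
      nlinarith [hx v]
  refine (Finset.sum_le_sum this).trans (le_of_eq ?_)
  rw [Finset.sum_add_distrib, Finset.sum_const, nsmul_eq_mul, mul_comm]

lemma cw_one (x : V → ℝ) : cliqueWeight G x 1 = ∑ u, x u := by
  rw [← cw_reindex]
  have : G.cliqueFinset 0 = {∅} := by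
    ext t
    simp [SimpleGraph.mem_cliqueFinset_iff]
  simp [this]

lemma cw_main (x : V → ℝ) (μ : ℝ) (hμ : 0 ≤ μ) (hx : ∀ u, 0 ≤ x u) (h1 : ∑ u, x u = 1)
    (h : ∀ u, μ * x u ≤ ∑ v, if G.Adj u v then x v else 0) (r : ℕ) (hr : 1 ≤ r) :
    μ ^ (r + 1) ≤ μ * cliqueWeight G x (r + 1) +
      ∑ s ∈ Finset.Icc 2 r, ((s : ℝ) - 1) * cliqueCount G s * μ ^ (r + 1 - s) := by
  induction r, hr using Nat.le_induction with
  | base =>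
    have := cw_step G x μ hx h1 h 1
    rw [cw_one, h1] at this
    simp at this ⊢
    nlinarith
  | succ r hr ih =>
    rw [Finset.sum_Icc_succ_top (by omega)]
    have hs := cw_step G x μ hx h1 h (r + 1)
    have e : ∑ s ∈ Finset.Icc 2 r, ((s : ℝ) - 1) * cliqueCount G s * μ ^ (r + 1 + 1 - s)
        = μ * ∑ s ∈ Finset.Icc 2 r, ((s : ℝ) - 1) * cliqueCount G s * μ ^ (r + 1 - s) := by
      rw [Finset.mul_sum]
      refine Finset.sum_congr rfl fun s hs => ?_
      rw [Finset.mem_Icc] at hs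
      rw [show r + 1 + 1 - s = (r + 1 - s) + 1 by omega, pow_succ]
      ring
    rw [e, show r + 1 + 1 - (r + 1) = 1 by omega, pow_one, pow_succ]
    have a := mul_le_mul_of_nonneg_left ih hμ
    have b := mul_le_mul_of_nonneg_left hs hμ
    nlinarith

lemma radius_nonneg [Nonempty V] : 0 ≤ adjSpectralRadius G := by
  have ht := (adjMatrix_isHermitian G).trace_eq_sum_eigenvalues
  rw [SimpleGraph.trace_adjMatrix] at ht
  by_contra! hneg
  have : ∑ i, (adjMatrix_isHermitian G).eigenvalues i < 0 := by
    refine Finset.sum_neg (fun i _ => lt_of_le_of_lt ?_ hneg) Finset.univ_nonempty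
    exact le_ciSup (Set.finite_range _).bddAbove i
  simp at ht
  linarith

lemma exists_weight [Nonempty V] : ∃ x : V → ℝ, (∀ u, 0 ≤ x u) ∧ ∑ u, x u = 1 ∧
    ∀ u, adjSpectralRadius G * x u ≤ ∑ v, if G.Adj u v then x v else 0 := by
  obtain ⟨i, hi⟩ := exists_eq_ciSup_of_finite (f := (adjMatrix_isHermitian G).eigenvalues)
  set μ := adjSpectralRadius G with hμ
  have hi' : (adjMatrix_isHermitian G).eigenvalues i = μ := hi
  have hv := (adjMatrix_isHermitian G).mulVec_eigenvectorBasis i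
  rw [hi'] at hv
  have hne : (adjMatrix_isHermitian G).eigenvectorBasis i ≠ 0 :=
    (adjMatrix_isHermitian G).eigenvectorBasis.orthonormal.ne_zero i
  set y := (adjMatrix_isHermitian G).eigenvectorBasis i
  have hS : 0 < ∑ u, |y u| := by
    refine lt_of_le_of_ne (Finset.sum_nonneg fun u _ => abs_nonneg _) fun h0 => hne ?_
    rw [eq_comm, Finset.sum_eq_zero_iff_of_nonneg (fun u _ => abs_nonneg _)] at h0
    ext u
    simpa using h0 u (Finset.mem_univ u)
  refine ⟨fun u => |y u| / ∑ u, |y u|, fun u => by positivity, ?_, fun u => ?_⟩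
  · rw [← Finset.sum_div, div_self hS.ne']
  · have hu := congrFun hv u
    have e : μ * y u = ∑ v, if G.Adj u v then y v else 0 := by
      simpa [Matrix.mulVec, dotProduct, SimpleGraph.adjMatrix_apply] using hu.symm
    have e2 : μ * |y u| ≤ ∑ v, if G.Adj u v then |y v| else 0 := by
      have hμ0 : 0 ≤ μ := radius_nonneg G
      have e1 : μ * |y u| = |μ * y u| := by rw [abs_mul, abs_of_nonneg hμ0]
      rw [e1, e]
      refine (Finset.abs_sum_le_sum_abs _ _).trans (Finset.sum_le_sum fun v _ => ?_)
      split_ifs <;> simp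
    have e3 : (∑ v, if G.Adj u v then |y v| / ∑ u, |y u| else 0)
        = (∑ v, if G.Adj u v then |y v| else 0) / ∑ u, |y u| := by
      rw [Finset.sum_div]
      refine Finset.sum_congr rfl fun v _ => ?_
      split_ifs <;> simp
    rw [e3, ← mul_div_assoc]
    gcongr

end Helpers

/-- **Bollobás–Nikiforov, Theorem 1.** For every graph `G` and every `r ≥ 2`,
`μ(G)^{r+1} ≤ (r+1)·k_{r+1}(G) + ∑_{s=2}^{r} (s-1)·k_s(G)·μ(G)^{r+1-s}`. -/
theorem spectral_radius_pow_le_clique_sum {V : Type*} [Fintype V] [DecidableEq V]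
    (G : SimpleGraph V) [DecidableRel G.Adj] (r : ℕ) (hr : 2 ≤ r) :
    adjSpectralRadius G ^ (r + 1) ≤
      ((r : ℝ) + 1) * cliqueCount G (r + 1) +
        ∑ s ∈ Finset.Icc 2 r,
          ((s : ℝ) - 1) * cliqueCount G s * adjSpectralRadius G ^ (r + 1 - s) := by
  rcases isEmpty_or_nonempty V with hV | hV
  · have h0 : adjSpectralRadius G = 0 := by
      unfold adjSpectralRadius
      exact Real.iSup_of_isEmpty _
    rw [h0, zero_pow (by omega)]
    refine add_nonneg (by positivity) (Finset.sum_nonneg fun s hs => ?_)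
    rw [Finset.mem_Icc] at hs
    have : (0 : ℝ) ≤ (s : ℝ) - 1 := by
      have : (2 : ℝ) ≤ s := by exact_mod_cast hs.1
      linarith
    positivity
  · obtain ⟨x, hx, h1, h⟩ := exists_weight G
    have a := cw_main G x _ (radius_nonneg G) hx h1 h r (by omega)
    have b := cw_last G x _ hx h1 h (r + 1)
    push_cast at b
    linarith
end

section
/- Let r, s be integers and α ≥ 0 a real number, with 1 ≤ s ≤ r < ω(G), and let G be a finite simple graph of order n. If (s+1)·k_{s+1}(G) ≥ n^{s+1} · Π_{t=1}^{s} ((r−t)/(r·t) + α), then k_{r+1}(G) ≥ α · (r²/(r+1)) · (n/r)^{r+1}. -/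
open Finset

/-- Number of vertices adjacent to all of `C`. -/
def extDeg {V : Type*} [Fintype V] [DecidableEq V] (G : SimpleGraph V) [DecidableRel G.Adj]
    (C : Finset V) : ℕ :=
  (univ.filter (fun v => ∀ u ∈ C, G.Adj v u)).card

lemma sum_clique_erase {V : Type*} [Fintype V] [DecidableEq V]
    (G : SimpleGraph V) [DecidableRel G.Adj] (m : ℕ) (f : Finset V → ℕ) :
    ∑ A ∈ G.cliqueFinset (m + 1), ∑ u ∈ A, f (A.erase u)
      = ∑ C ∈ G.cliqueFinset m, extDeg G C * f C := by
  have h1 : ∀ C ∈ G.cliqueFinset m, extDeg G C * f C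
      = ∑ v ∈ univ.filter (fun v => ∀ u ∈ C, G.Adj v u), f C := by
    intro C _
    simp [extDeg]
  rw [Finset.sum_congr rfl h1, Finset.sum_sigma', Finset.sum_sigma']
  refine Finset.sum_bij' (fun p _ => ⟨p.1.erase p.2, p.2⟩) (fun p _ => ⟨insert p.2 p.1, p.2⟩)
    ?_ ?_ ?_ ?_ ?_
  · rintro ⟨A, u⟩ h
    simp only [mem_sigma, SimpleGraph.mem_cliqueFinset_iff, mem_filter, mem_univ, true_and] at h ⊢
    obtain ⟨hA, hu⟩ := h
    refine ⟨⟨hA.isClique.subset (by simp), by rw [card_erase_of_mem hu, hA.card_eq]; rfl⟩, ?_⟩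
    intro w hw
    exact hA.isClique hu (mem_of_mem_erase hw) (ne_of_mem_erase hw).symm
  · rintro ⟨C, v⟩ h
    simp only [mem_sigma, SimpleGraph.mem_cliqueFinset_iff, mem_filter, mem_univ, true_and] at h ⊢
    exact ⟨h.1.insert h.2, by simp⟩
  · rintro ⟨A, u⟩ h
    simp only [mem_sigma] at h
    simp [insert_erase h.2]
  · rintro ⟨C, v⟩ h
    simp only [mem_sigma, SimpleGraph.mem_cliqueFinset_iff, mem_filter, mem_univ, true_and] at h
    have : v ∉ C := fun hv => G.loopless.irrefl v (h.2 v hv)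
    simp [erase_insert this]
  · rintro ⟨A, u⟩ h
    rfl

lemma sum_extDeg {V : Type*} [Fintype V] [DecidableEq V]
    (G : SimpleGraph V) [DecidableRel G.Adj] (m : ℕ) :
    ∑ C ∈ G.cliqueFinset m, extDeg G C = (m + 1) * cliqueCount G (m + 1) := by
  have h := sum_clique_erase G m (fun _ => 1)
  simp only [mul_one, sum_const, smul_eq_mul] at h
  rw [← h, Finset.sum_congr rfl (fun A hA =>
    ((SimpleGraph.mem_cliqueFinset_iff).1 hA).card_eq), sum_const, cliqueCount, smul_eq_mul, mul_comm]

lemma local_bound {V : Type*} [Fintype V] [DecidableEq V]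
    (G : SimpleGraph V) [DecidableRel G.Adj] (m : ℕ) (A : Finset V)
    (hA : A.card = m + 1) :
    ∑ u ∈ A, extDeg G (A.erase u) ≤ Fintype.card V + m * extDeg G A := by
  simp only [extDeg, card_filter]
  rw [sum_comm, mul_sum, ← card_univ, card_eq_sum_ones, ← sum_add_distrib]
  refine sum_le_sum fun v _ => ?_
  rw [← card_filter (fun x => ∀ u ∈ A.erase x, G.Adj v u)]
  by_cases h : ∀ u ∈ A, G.Adj v u
  · rw [if_pos h]
    have := card_filter_le A (fun u => ∀ w ∈ A.erase u, G.Adj v w)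
    omega
  · rw [if_neg h, mul_zero, add_zero, card_le_one]
    push Not at h
    obtain ⟨x, hx, hvx⟩ := h
    have key : ∀ a, (∀ w ∈ A.erase a, G.Adj v w) → x = a := by
      intro a ha
      by_contra hne
      exact hvx (ha x (mem_erase.2 ⟨hne, hx⟩))
    intro a ha b hb
    rw [← key a (mem_filter.1 ha).2, ← key b (mem_filter.1 hb).2]

lemma moon_moser {V : Type*} [Fintype V] [DecidableEq V]
    (G : SimpleGraph V) [DecidableRel G.Adj] (m : ℕ) :
    ((m + 1) * cliqueCount G (m + 1)) ^ 2 ≤ cliqueCount G m *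
      (Fintype.card V * cliqueCount G (m + 1) + m * ((m + 2) * cliqueCount G (m + 2))) := by
  rw [← sum_extDeg]
  refine sq_sum_le_card_mul_sum_sq.trans (Nat.mul_le_mul_left _ ?_)
  simp only [sq]
  rw [← sum_clique_erase G m (extDeg G)]
  refine (sum_le_sum (fun A hA => local_bound G m A
    ((SimpleGraph.mem_cliqueFinset_iff).1 hA).card_eq)).trans ?_
  rw [sum_add_distrib, ← mul_sum, sum_extDeg, sum_const, smul_eq_mul, mul_comm]
  exact le_rfl

lemma cliqueCount_pos {V : Type*} [Fintype V] [DecidableEq V]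
    (G : SimpleGraph V) [DecidableRel G.Adj] (t : ℕ) (ht : t ≤ G.cliqueNum) :
    0 < cliqueCount G t := by
  obtain ⟨S, hS⟩ := G.exists_isNClique_cliqueNum
  obtain ⟨T, hT, hc⟩ := exists_subset_card_eq (ht.trans hS.card_eq.ge)
  exact card_pos.2 ⟨T, (SimpleGraph.mem_cliqueFinset_iff).2
    ⟨hS.isClique.subset (by exact_mod_cast hT), hc⟩⟩

lemma cliqueCount_one' {V : Type*} [Fintype V] [DecidableEq V]
    (G : SimpleGraph V) [DecidableRel G.Adj] : cliqueCount G 1 = Fintype.card V := by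
  have h := sum_extDeg G 0
  have h0 : G.cliqueFinset 0 = {∅} := by
    ext A; simp [SimpleGraph.mem_cliqueFinset_iff, SimpleGraph.isNClique_zero]
  simpa [h0, extDeg] using h.symm

lemma prod_base (j r : ℕ) (hr : 0 < r) (hj : j < r) :
    (∏ t ∈ Finset.Icc 1 j, (((r : ℝ) - t) / ((r : ℝ) * t))) = ((r - 1).choose j : ℝ) / r ^ j := by
  induction j with
  | zero => simp
  | succ j ih =>
    rw [Finset.prod_Icc_succ_top (by omega), ih (by omega)]
    have h := Nat.choose_succ_right_eq (r - 1) j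
    have h' : ((r - 1).choose (j + 1) : ℝ) * (j + 1) = (r - 1).choose j * ((r : ℝ) - (j + 1)) := by
      have : ((r - 1 - j : ℕ) : ℝ) = (r : ℝ) - (j + 1) := by
        rw [show r - 1 - j = r - (j + 1) by omega, Nat.cast_sub (by omega)]; push_cast; ring
      rw [← this]; exact_mod_cast h
    have hr' : (r : ℝ) ≠ 0 := by positivity
    have hj' : (j : ℝ) + 1 ≠ 0 := by positivity
    push_cast
    field_simp
    linear_combination (-(r : ℝ) ^ (j + 1)) * h'

/-- **Bollobás–Nikiforov, Theorem 3.** Let `1 ≤ s ≤ r < ω(G)` and `α ≥ 0`. If `G` has order `n`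
and `(s+1)·k_{s+1}(G) ≥ n^{s+1} · ∏_{t=1}^{s} ((r−t)/(rt) + α)`, then
`k_{r+1}(G) ≥ α · (r²/(r+1)) · (n/r)^{r+1}`. -/
theorem cliqueCount_ge_of_cliqueCount_cond {V : Type*} [Fintype V] [DecidableEq V]
    (G : SimpleGraph V) [DecidableRel G.Adj] (r s : ℕ) (α : ℝ) (hα : 0 ≤ α)
    (hs1 : 1 ≤ s) (hsr : s ≤ r) (hrω : r < G.cliqueNum)
    (n : ℕ) (hn : n = Fintype.card V)
    (hcond : ((s : ℝ) + 1) * cliqueCount G (s + 1) ≥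
      (n : ℝ) ^ (s + 1) * ∏ t ∈ Finset.Icc 1 s, (((r : ℝ) - t) / ((r : ℝ) * t) + α)) :
    (cliqueCount G (r + 1) : ℝ) ≥ α * ((r : ℝ) ^ 2 / ((r : ℝ) + 1)) * ((n : ℝ) / r) ^ (r + 1) := by
  subst hn
  have hr : 0 < r := by omega
  have hrR : (0 : ℝ) < r := by exact_mod_cast hr
  set n : ℝ := (Fintype.card V : ℝ) with hn
  have hkpos : ∀ t, t ≤ r + 1 → (0 : ℝ) < cliqueCount G t := fun t ht => by
    exact_mod_cast cliqueCount_pos G t (by omega)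
  have hk1 : (cliqueCount G 1 : ℝ) = n := by rw [cliqueCount_one']
  have hnpos : 0 < n := hk1 ▸ hkpos 1 (by omega)
  let w : ℕ → ℝ := fun t => ((t : ℝ) + 1) * cliqueCount G (t + 1) / (t * n * cliqueCount G t)
  have hwpos : ∀ t, 1 ≤ t → t ≤ r → 0 < w t := by
    intro t h1 h2
    have := hkpos t (by omega)
    have := hkpos (t + 1) (by omega)
    have : (0 : ℝ) < t := by exact_mod_cast h1
    positivity
  let c : ℕ → ℝ := fun t => ((r : ℝ) - t) / ((r : ℝ) * t)
  have hc0 : ∀ t, t ≤ r → 0 ≤ c t := by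
    intro t h
    have : (t : ℝ) ≤ r := by exact_mod_cast h
    exact div_nonneg (by linarith) (by positivity)
  have hprod : ∀ j, j ≤ r → ∏ t ∈ Finset.Icc 1 j, w t
      = ((j : ℝ) + 1) * cliqueCount G (j + 1) / n ^ (j + 1) := by
    intro j
    induction j with
    | zero => intro _; simp [hk1, hnpos.ne']
    | succ j ih =>
      intro hj
      rw [Finset.prod_Icc_succ_top (by omega), ih (by omega)]
      have := (hkpos (j + 1) (by omega)).ne'
      simp only [w]
      have : (j : ℝ) + 1 ≠ 0 := by positivity
      push_cast
      field_simp
      ring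
  have hstep : ∀ m, 1 ≤ m → m + 1 ≤ r → w m - c m ≤ w (m + 1) - c (m + 1) := by
    intro m h1 h2
    have hmm : (((m : ℝ) + 1) * cliqueCount G (m + 1)) ^ 2 ≤ cliqueCount G m *
      (n * cliqueCount G (m + 1) + m * ((m + 2) * cliqueCount G (m + 2))) := by
      rw [hn]; exact_mod_cast moon_moser G m
    have ha := hkpos m (by omega)
    have hb := hkpos (m + 1) (by omega)
    have hm : (0 : ℝ) < m := by exact_mod_cast h1
    have hD : 0 < (m : ℝ) * (m + 1) * n * cliqueCount G m * cliqueCount G (m + 1) := by positivity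
    have e : (w (m + 1) - c (m + 1)) - (w m - c m) = (cliqueCount G m *
      (n * cliqueCount G (m + 1) + m * ((m + 2) * cliqueCount G (m + 2)))
        - (((m : ℝ) + 1) * cliqueCount G (m + 1)) ^ 2) /
        ((m : ℝ) * (m + 1) * n * cliqueCount G m * cliqueCount G (m + 1)) := by
      simp only [w, c]
      push_cast
      field_simp
      ring
    have := div_nonneg (sub_nonneg.2 hmm) hD.le
    linarith
  have hmono : ∀ a b, 1 ≤ a → a ≤ b → b ≤ r → w a - c a ≤ w b - c b := by
    intro a b ha hab
    induction b, hab using Nat.le_induction with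
    | base => intro _; exact le_rfl
    | succ b hb ih => intro h; exact (ih (by omega)).trans (hstep b (by omega) h)
  have hcond' : ∏ t ∈ Finset.Icc 1 s, (c t + α) ≤ ∏ t ∈ Finset.Icc 1 s, w t := by
    rw [hprod s hsr, le_div_iff₀ (by positivity), mul_comm]
    exact hcond
  have hzs : α ≤ w s - c s := by
    by_contra! hlt
    refine absurd hcond' (not_le.2 ?_)
    refine Finset.prod_lt_prod_of_nonempty ?_ ?_ ⟨1, by simp [hs1]⟩
    · intro t ht
      rw [mem_Icc] at ht
      exact hwpos t ht.1 (by omega)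
    · intro t ht
      rw [mem_Icc] at ht
      have := hmono t s ht.1 ht.2 hsr
      linarith
  have hall : ∀ j, s ≤ j → j ≤ r → ∏ t ∈ Finset.Icc 1 j, (c t + α) ≤ ∏ t ∈ Finset.Icc 1 j, w t := by
    intro j hj
    induction j, hj using Nat.le_induction with
    | base => intro _; exact hcond'
    | succ j hj ih =>
      intro h
      rw [Finset.prod_Icc_succ_top (by omega), Finset.prod_Icc_succ_top (by omega)]
      have h3 := hmono s (j + 1) hs1 (by omega) h
      have h4 := hc0 (j + 1) h
      refine mul_le_mul (ih (by omega)) (by linarith) (by linarith) ?_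
      refine prod_nonneg fun t ht => ?_
      rw [mem_Icc] at ht
      exact (hwpos t ht.1 (by omega)).le
  have hfin := hall r hsr le_rfl
  rw [hprod r le_rfl] at hfin
  obtain ⟨q, rfl⟩ : ∃ q, r = q + 1 := ⟨r - 1, by omega⟩
  rw [Finset.prod_Icc_succ_top (by omega)] at hfin
  have hb := prod_base q (q + 1) (by omega) (by omega)
  have hle : ∏ t ∈ Finset.Icc 1 q, c t ≤ ∏ t ∈ Finset.Icc 1 q, (c t + α) := by
    refine prod_le_prod (fun t ht => ?_) (fun t ht => by linarith)
    rw [mem_Icc] at ht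
    exact hc0 t (by omega)
  have hcr : c (q + 1) = 0 := by simp [c]
  rw [hcr, zero_add] at hfin
  have hb' : ∏ t ∈ Finset.Icc 1 q, c t = 1 / ((q + 1 : ℕ) : ℝ) ^ q := by
    rw [show ((1 : ℝ)) = (((q + 1 - 1).choose q : ℕ) : ℝ) by simp]; exact hb
  rw [hb'] at hle
  have hfin2 := (mul_le_mul_of_nonneg_right hle hα).trans hfin
  rw [le_div_iff₀ (by positivity)] at hfin2
  have e : α * (((q + 1 : ℕ) : ℝ) ^ 2 / (((q + 1 : ℕ) : ℝ) + 1)) * (n / ((q + 1 : ℕ) : ℝ)) ^ (q + 1 + 1)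
      = (1 / ((q + 1 : ℕ) : ℝ) ^ q * α * n ^ (q + 1 + 1)) / (((q + 1 : ℕ) : ℝ) + 1) := by
    rw [div_pow]
    have : (((q + 1 : ℕ) : ℝ)) ≠ 0 := hrR.ne'
    generalize ((q + 1 : ℕ) : ℝ) = R at *
    field_simp
    ring
  rw [ge_iff_le, e, div_le_iff₀ (by positivity)]
  linarith
end

section
/- For every finite simple graph G with at least one edge and clique number ω = ω(G), the spectral radius satisfies μ(G)^{ω} ≤ Σ_{s=2}^{ω} (s−1)·k_s(G)·μ(G)^{ω−s}. -/
open Finset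

/-- Double counting of pairs (clique, vertex in it). -/
lemma aux_double {V : Type*} [Fintype V] [DecidableEq V] (G : SimpleGraph V)
    [DecidableRel G.Adj] (x : V → ℝ) (s : ℕ) :
    ∑ K ∈ G.cliqueFinset s, ∑ v ∈ univ.filter (fun v => ∀ u ∈ K, G.Adj u v), x v =
      ∑ L ∈ G.cliqueFinset (s + 1), ∑ v ∈ L, x v := by
  rw [Finset.sum_sigma', Finset.sum_sigma']
  refine Finset.sum_bij' (fun p _ => ⟨insert p.2 p.1, p.2⟩) (fun p _ => ⟨p.1.erase p.2, p.2⟩)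
    ?_ ?_ ?_ ?_ ?_
  · rintro ⟨K, v⟩ h
    simp only [Finset.mem_sigma, SimpleGraph.mem_cliqueFinset_iff, Finset.mem_filter,
      Finset.mem_univ, true_and] at h ⊢
    exact ⟨h.1.insert (fun b hb => (h.2 b hb).symm), Finset.mem_insert_self _ _⟩
  · rintro ⟨L, v⟩ h
    simp only [Finset.mem_sigma, SimpleGraph.mem_cliqueFinset_iff, Finset.mem_filter,
      Finset.mem_univ, true_and] at h ⊢
    refine ⟨⟨h.1.1.subset (by simp), ?_⟩, ?_⟩
    · rw [Finset.card_erase_of_mem h.2, h.1.2]; rfl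
    · intro u hu
      rw [Finset.mem_erase] at hu
      exact h.1.1 hu.2 h.2 hu.1
  · rintro ⟨K, v⟩ h
    simp only [Finset.mem_sigma, SimpleGraph.mem_cliqueFinset_iff, Finset.mem_filter,
      Finset.mem_univ, true_and] at h
    have : v ∉ K := fun hv => G.irrefl (h.2 v hv)
    simp [Finset.erase_insert this]
  · rintro ⟨L, v⟩ h
    simp only [Finset.mem_sigma] at h
    simp [Finset.insert_erase h.2]
  · intros; rfl

lemma aux_clique {V : Type*} [Fintype V] [DecidableEq V] (G : SimpleGraph V)
    [DecidableRel G.Adj] (x : V → ℝ) (hx : ∀ v, 0 ≤ x v) (K : Finset V) :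
    ∑ u ∈ K, (∑ v, if G.Adj u v then x v else 0) ≤
      ((K.card : ℝ) - 1) * ∑ v, x v + ∑ v ∈ univ.filter (fun v => ∀ u ∈ K, G.Adj u v), x v := by
  rw [Finset.sum_comm, Finset.mul_sum, Finset.sum_filter, ← Finset.sum_add_distrib]
  refine Finset.sum_le_sum fun v _ => ?_
  rw [← Finset.sum_filter, Finset.sum_const, nsmul_eq_mul]
  split_ifs with h
  · have : (#{a ∈ K | G.Adj a v} : ℝ) ≤ K.card := by exact_mod_cast Finset.card_filter_le _ _
    nlinarith [hx v]
  · have : #{a ∈ K | G.Adj a v} < K.card := by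
      push Not at h
      obtain ⟨u, hu, hn⟩ := h
      exact Finset.card_lt_card (Finset.filter_ssubset.2 ⟨u, hu, hn⟩)
    have : (#{a ∈ K | G.Adj a v} : ℝ) + 1 ≤ K.card := by exact_mod_cast this
    nlinarith [hx v]

lemma aux_step {V : Type*} [Fintype V] [DecidableEq V] (G : SimpleGraph V)
    [DecidableRel G.Adj] (x : V → ℝ) (hx : ∀ v, 0 ≤ x v) (m : ℝ)
    (hm : ∀ u, m * x u ≤ ∑ v, if G.Adj u v then x v else 0) (s : ℕ) :
    m * ∑ K ∈ G.cliqueFinset s, ∑ v ∈ K, x v ≤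
      ((s : ℝ) - 1) * cliqueCount G s * ∑ v, x v +
        ∑ K ∈ G.cliqueFinset (s + 1), ∑ v ∈ K, x v := by
  rw [← aux_double, Finset.mul_sum]
  calc _ ≤ ∑ K ∈ G.cliqueFinset s, (((s : ℝ) - 1) * ∑ v, x v +
        ∑ v ∈ univ.filter (fun v => ∀ u ∈ K, G.Adj u v), x v) := by
        refine Finset.sum_le_sum fun K hK => ?_
        have hc := ((SimpleGraph.mem_cliqueFinset_iff).1 hK).2
        have := aux_clique G x hx K
        rw [hc] at this
        refine le_trans ?_ this
        rw [Finset.mul_sum]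
        exact Finset.sum_le_sum fun u _ => hm u
    _ = _ := by
        rw [Finset.sum_add_distrib, Finset.sum_const, nsmul_eq_mul, cliqueCount]
        ring

lemma aux_iter {V : Type*} [Fintype V] [DecidableEq V] (G : SimpleGraph V)
    [DecidableRel G.Adj] (x : V → ℝ) (hx : ∀ v, 0 ≤ x v) (m : ℝ) (h0 : 0 ≤ m)
    (hm : ∀ u, m * x u ≤ ∑ v, if G.Adj u v then x v else 0) (t : ℕ) :
    m ^ t * ∑ v, x v ≤
      (∑ s ∈ Finset.Icc 1 t, ((s : ℝ) - 1) * cliqueCount G s * m ^ (t - s)) * ∑ v, x v +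
        ∑ K ∈ G.cliqueFinset (t + 1), ∑ v ∈ K, x v := by
  induction t with
  | zero =>
    rw [← aux_double]
    have : G.cliqueFinset 0 = {∅} := by
      ext K
      simp [SimpleGraph.mem_cliqueFinset_iff]
    simp [this]
  | succ t ih =>
    have h1 := mul_le_mul_of_nonneg_left ih h0
    have h2 := aux_step G x hx m hm (t + 1)
    rw [Finset.sum_Icc_succ_top (by omega)]
    have h3 : ∑ s ∈ Finset.Icc 1 t, ((s : ℝ) - 1) * cliqueCount G s * m ^ (t + 1 - s) =
        m * ∑ s ∈ Finset.Icc 1 t, ((s : ℝ) - 1) * cliqueCount G s * m ^ (t - s) := by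
      rw [Finset.mul_sum]
      refine Finset.sum_congr rfl fun s hs => ?_
      rw [Finset.mem_Icc] at hs
      rw [Nat.succ_sub hs.2, pow_succ]
      ring
    rw [h3, pow_succ, Nat.sub_self, pow_zero]
    linarith

lemma aux_vec {V : Type*} [Fintype V] [DecidableEq V] [Nonempty V] (G : SimpleGraph V)
    [DecidableRel G.Adj] : 0 ≤ adjSpectralRadius G ∧ ∃ x : V → ℝ, (∀ v, 0 ≤ x v) ∧
      0 < ∑ v, x v ∧
      ∀ u, adjSpectralRadius G * x u ≤ ∑ v, if G.Adj u v then x v else 0 := by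
  have hA := adjMatrix_isHermitian G
  have h0 : 0 ≤ adjSpectralRadius G := by
    by_contra! hneg
    have htr := hA.trace_eq_sum_eigenvalues
    rw [SimpleGraph.trace_adjMatrix] at htr
    have : ∑ i, hA.eigenvalues i < 0 := by
      refine Finset.sum_neg (fun i _ => lt_of_le_of_lt ?_ hneg) Finset.univ_nonempty
      exact le_ciSup (f := hA.eigenvalues) (Set.finite_range _).bddAbove i
    simp at htr
    linarith
  refine ⟨h0, ?_⟩
  obtain ⟨i, hi⟩ := exists_eq_ciSup_of_finite (f := hA.eigenvalues)
  have hi' : adjSpectralRadius G = hA.eigenvalues i := hi.symm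
  have hev := hA.mulVec_eigenvectorBasis i
  set y := hA.eigenvectorBasis i with hy
  refine ⟨fun v => |y v|, fun v => abs_nonneg _, ?_, ?_⟩
  · have hne : y ≠ 0 := by
      intro h
      have := hA.eigenvectorBasis.orthonormal.1 i
      rw [← hy, h] at this
      simp at this
    have : ∃ v, y v ≠ 0 := by
      by_contra! h
      exact hne (by ext v; simpa using h v)
    obtain ⟨v, hv⟩ := this
    exact Finset.sum_pos' (fun _ _ => abs_nonneg _) ⟨v, Finset.mem_univ _, abs_pos.2 hv⟩
  · intro u
    have h := congrFun hev u
    simp only [Matrix.mulVec, dotProduct, SimpleGraph.adjMatrix_apply, ite_mul, one_mul,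
      zero_mul, Pi.smul_apply, smul_eq_mul] at h
    rw [← hi'] at h
    calc adjSpectralRadius G * |y u| = |adjSpectralRadius G * y u| := by
          rw [abs_mul, abs_of_nonneg h0]
      _ = |∑ v, if G.Adj u v then y v else 0| := by rw [← h]
      _ ≤ ∑ v, |if G.Adj u v then y v else 0| := Finset.abs_sum_le_sum_abs _ _
      _ = _ := by
          refine Finset.sum_congr rfl fun v _ => ?_
          split_ifs <;> simp


/-- **Nikiforov (2002).** For every graph `G` with at least one edge and clique number
`ω = ω(G)`, `μ(G)^ω ≤ ∑_{s=2}^{ω} (s−1)·k_s(G)·μ(G)^{ω−s}`. -/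
theorem spectral_radius_pow_cliqueNum_le {V : Type*} [Fintype V] [DecidableEq V]
    (G : SimpleGraph V) [DecidableRel G.Adj] (hedge : ∃ u v, G.Adj u v) :
    adjSpectralRadius G ^ G.cliqueNum ≤
      ∑ s ∈ Finset.Icc 2 G.cliqueNum,
        ((s : ℝ) - 1) * cliqueCount G s * adjSpectralRadius G ^ (G.cliqueNum - s) := by
  obtain ⟨a, -, -⟩ := hedge
  have : Nonempty V := ⟨a⟩
  obtain ⟨h0, x, hx, hpos, hm⟩ := aux_vec G
  have h := aux_iter G x hx _ h0 hm G.cliqueNum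
  have hempty : G.cliqueFinset (G.cliqueNum + 1) = ∅ := by
    rw [Finset.eq_empty_iff_forall_notMem]
    intro K hK
    rw [SimpleGraph.mem_cliqueFinset_iff] at hK
    have := hK.1.card_le_cliqueNum
    rw [hK.2] at this
    omega
  rw [hempty, Finset.sum_empty, add_zero] at h
  refine (le_of_mul_le_mul_right h hpos).trans (le_of_eq ?_)
  symm
  refine Finset.sum_subset (Finset.Icc_subset_Icc_left (by norm_num)) fun s hs hs' => ?_
  have : s = 1 := by
    simp only [Finset.mem_Icc] at hs hs'
    omega
  subst this
  simp
end

section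
/- For every finite simple graph G with at least one edge and every integer s ≥ 1, the spectral radius satisfies μ(G)^{s} ≤ ((ω(G)−1)/ω(G)) · w_s(G). -/
open Finset

section Helpers
open Matrix

variable {V : Type*} [Fintype V] [DecidableEq V]

lemma jensen_aux (M : V → V → ℝ) (hM0 : ∀ i j, 0 ≤ M i j) (hMs : ∀ i j, M i j = M j i)
    (x : V → ℝ) (hx : ∀ i, 0 ≤ x i) (hx1 : ∑ i, x i ^ 2 = 1) (l : ℝ) (hl : 0 < l)
    (he : ∀ i, ∑ j, M i j * x j = l * x i) (c : ℝ) :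
    l * Real.exp (c * (2 * ∑ i, x i ^ 2 * Real.log (x i))) ≤
      ∑ i, ∑ j, M i j * x i * x j * Real.exp (c * (Real.log (x i) + Real.log (x j))) := by
  have key : ∀ f : V → ℝ, ∑ i, ∑ j, M i j * x i * x j * f i = l * ∑ i, x i ^ 2 * f i := by
    intro f
    rw [Finset.mul_sum]
    refine Finset.sum_congr rfl fun i _ => ?_
    calc ∑ j, M i j * x i * x j * f i = (∑ j, M i j * x j) * (x i * f i) := by
          rw [Finset.sum_mul]; exact Finset.sum_congr rfl fun j _ => by ring
      _ = _ := by rw [he]; ring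
  have key2 : ∀ f : V → ℝ, ∑ i, ∑ j, M i j * x i * x j * f j = l * ∑ i, x i ^ 2 * f i := by
    intro f
    rw [← key f, Finset.sum_comm]
    refine Finset.sum_congr rfl fun i _ => Finset.sum_congr rfl fun j _ => ?_
    rw [hMs j i]; ring
  have hJ := convexOn_exp.map_sum_le (t := (Finset.univ : Finset (V × V)))
    (w := fun q => M q.1 q.2 * x q.1 * x q.2 / l)
    (p := fun q => c * (Real.log (x q.1) + Real.log (x q.2)))
    (fun q _ => div_nonneg (mul_nonneg (mul_nonneg (hM0 _ _) (hx _)) (hx _)) hl.le)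
    (by
      rw [Fintype.sum_prod_type]
      have := key (fun _ => 1)
      simp only [mul_one, hx1] at this
      simp only [← Finset.sum_div, this]
      exact div_self hl.ne') (fun _ _ => Set.mem_univ _)
  simp only [smul_eq_mul, Fintype.sum_prod_type] at hJ
  have e1 : ∑ i, ∑ j, M i j * x i * x j / l * (c * (Real.log (x i) + Real.log (x j)))
      = c * (2 * ∑ i, x i ^ 2 * Real.log (x i)) := by
    have h1 := key (fun i => Real.log (x i))
    have h2 := key2 (fun i => Real.log (x i))
    calc _ = c / l * (∑ i, ∑ j, M i j * x i * x j * Real.log (x i)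
              + ∑ i, ∑ j, M i j * x i * x j * Real.log (x j)) := by
          rw [← Finset.sum_add_distrib, Finset.mul_sum]
          refine Finset.sum_congr rfl fun i _ => ?_
          rw [← Finset.sum_add_distrib, Finset.mul_sum]
          refine Finset.sum_congr rfl fun j _ => ?_
          ring
      _ = _ := by rw [h1, h2]; field_simp; ring
  have e2 : ∑ i, ∑ j, M i j * x i * x j / l * Real.exp (c * (Real.log (x i) + Real.log (x j)))
      = (∑ i, ∑ j, M i j * x i * x j * Real.exp (c * (Real.log (x i) + Real.log (x j)))) / l := by
    rw [Finset.sum_div]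
    refine Finset.sum_congr rfl fun i _ => ?_
    rw [Finset.sum_div]
    refine Finset.sum_congr rfl fun j _ => ?_
    ring
  rw [e1, e2, le_div_iff₀ hl] at hJ
  linarith

lemma motzkin_straus_aux (G : SimpleGraph V) [DecidableRel G.Adj] (hpos : 0 < G.cliqueNum) :
    ∀ (n : ℕ) (x : V → ℝ), (∀ i, 0 ≤ x i) → ∑ i, x i = 1 →
      (Finset.univ.filter (fun i => x i ≠ 0)).card = n →
      x ⬝ᵥ (G.adjMatrix ℝ *ᵥ x) ≤ ((G.cliqueNum : ℝ) - 1) / G.cliqueNum := by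
  intro n
  induction n using Nat.strong_induction_on with
  | _ n ih =>
  intro x hx hx1 hn
  set S := Finset.univ.filter (fun i => x i ≠ 0) with hS
  by_cases hc : G.IsClique (S : Set V)
  · have hcard : S.card ≤ G.cliqueNum := SimpleGraph.IsClique.card_le_cliqueNum (tc := hc)
    have hsum : ∑ i ∈ S, x i = 1 := by
      rw [← hx1]
      exact Finset.sum_subset (Finset.subset_univ _) (by intro i _ hi; simpa [hS] using hi)
    have hsq : ∑ i ∈ S, x i ^ 2 ≤ ∑ i, x i ^ 2 :=
      Finset.sum_le_sum_of_subset_of_nonneg (Finset.subset_univ _) (fun i _ _ => sq_nonneg _)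
    have hcs := sq_sum_le_card_mul_sum_sq (s := S) (f := x)
    rw [hsum] at hcs
    have hw : (0 : ℝ) < G.cliqueNum := by exact_mod_cast hpos
    have hcardR : (S.card : ℝ) ≤ G.cliqueNum := by exact_mod_cast hcard
    have h0 : 0 ≤ ∑ i, x i ^ 2 := Finset.sum_nonneg fun i _ => sq_nonneg _
    have h1 : (1 : ℝ) ≤ G.cliqueNum * ∑ i, x i ^ 2 := by
      calc (1 : ℝ) = 1 ^ 2 := by norm_num
        _ ≤ S.card * ∑ i ∈ S, x i ^ 2 := hcs
        _ ≤ S.card * ∑ i, x i ^ 2 := by gcongr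
        _ ≤ _ := by gcongr
    have hQ : x ⬝ᵥ (G.adjMatrix ℝ *ᵥ x) ≤ 1 - ∑ i, x i ^ 2 := by
      have : (1 : ℝ) - ∑ i, x i ^ 2 = ∑ i, x i * ∑ j, (if i = j then 0 else 1) * x j := by
        have h2 : ∀ i, ∑ j, (if i = j then (0 : ℝ) else 1) * x j = 1 - x i := by
          intro i
          rw [eq_sub_iff_add_eq]
          refine Eq.trans ?_ hx1
          have hxi : x i = ∑ j, if i = j then x j else 0 := by simp
          rw [hxi, ← Finset.sum_add_distrib]
          refine Finset.sum_congr rfl fun j _ => ?_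
          split_ifs <;> simp
        simp only [h2, mul_sub, mul_one, Finset.sum_sub_distrib, hx1, sq]
      rw [this]
      simp only [dotProduct, mulVec, SimpleGraph.adjMatrix_apply]
      refine Finset.sum_le_sum fun i _ => mul_le_mul_of_nonneg_left ?_ (hx i)
      refine Finset.sum_le_sum fun j _ => mul_le_mul_of_nonneg_right ?_ (hx j)
      by_cases hij : i = j
      · subst hij; simp
      · simp only [hij, if_false]; split_ifs <;> norm_num
    refine hQ.trans ?_
    rw [le_div_iff₀ hw]
    nlinarith
  · have hex : ∃ u v, x u ≠ 0 ∧ x v ≠ 0 ∧ u ≠ v ∧ ¬ G.Adj u v ∧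
        (G.adjMatrix ℝ *ᵥ x) v ≤ (G.adjMatrix ℝ *ᵥ x) u := by
      simp only [SimpleGraph.isClique_iff, Set.Pairwise] at hc
      push Not at hc
      obtain ⟨u, hu, v, hv, huv, hadj⟩ := hc
      have hu' : x u ≠ 0 := by simpa [hS] using hu
      have hv' : x v ≠ 0 := by simpa [hS] using hv
      rcases le_total ((G.adjMatrix ℝ *ᵥ x) v) ((G.adjMatrix ℝ *ᵥ x) u) with h | h
      · exact ⟨u, v, hu', hv', huv, hadj, h⟩
      · exact ⟨v, u, hv', hu', huv.symm, fun h => hadj h.symm, h⟩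
    obtain ⟨u, v, hu, hv, huv, hadj, hle⟩ := hex
    set d : V → ℝ := Pi.single u 1 - Pi.single v 1 with hd
    set y : V → ℝ := x + x v • d with hy
    have hyv : y v = 0 := by simp [hy, hd, huv.symm]
    have hyu : y u = x u + x v := by simp [hy, hd, huv]
    have hyo : ∀ i, i ≠ u → i ≠ v → y i = x i := by
      intro i h1 h2; simp [hy, hd, h1, h2]
    have hy0 : ∀ i, 0 ≤ y i := by
      intro i
      by_cases h1 : i = u
      · subst h1; rw [hyu]; exact add_nonneg (hx _) (hx _)
      by_cases h2 : i = v
      · subst h2; rw [hyv]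
      rw [hyo i h1 h2]; exact hx i
    have hy1 : ∑ i, y i = 1 := by
      simp [hy, hd, Finset.sum_add_distrib, hx1, ← Finset.mul_sum]
    have hlt : (Finset.univ.filter (fun i => y i ≠ 0)).card < n := by
      rw [← hn]
      apply Finset.card_lt_card
      rw [Finset.ssubset_iff_of_subset]
      · exact ⟨v, by simpa [hS] using hv, by simp [hyv]⟩
      · intro i hi
        have hi' : y i ≠ 0 := by simpa using hi
        have : x i ≠ 0 := by
          by_cases h1 : i = u
          · subst h1; exact hu
          by_cases h2 : i = v
          · subst h2; exact hv
          rwa [hyo i h1 h2] at hi'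
        simpa [hS] using this
    have hyQ := ih _ hlt y hy0 hy1 rfl
    refine le_trans ?_ hyQ
    have hvu : ¬ G.Adj v u := fun h => hadj h.symm
    have hdd : d ⬝ᵥ (G.adjMatrix ℝ *ᵥ d) = 0 := by
      simp [hd, mulVec_sub, sub_dotProduct, hadj, hvu]
    have hdx : d ⬝ᵥ (G.adjMatrix ℝ *ᵥ x) = (G.adjMatrix ℝ *ᵥ x) u - (G.adjMatrix ℝ *ᵥ x) v := by
      simp only [hd, sub_dotProduct, single_dotProduct, one_mul]
    have hxd : x ⬝ᵥ (G.adjMatrix ℝ *ᵥ d) = d ⬝ᵥ (G.adjMatrix ℝ *ᵥ x) := by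
      rw [dotProduct_mulVec, ← mulVec_transpose, SimpleGraph.transpose_adjMatrix, dotProduct_comm]
    have : y ⬝ᵥ (G.adjMatrix ℝ *ᵥ y) = x ⬝ᵥ (G.adjMatrix ℝ *ᵥ x)
        + 2 * (x v * (d ⬝ᵥ (G.adjMatrix ℝ *ᵥ x))) := by
      simp only [hy, mulVec_add, mulVec_smul, add_dotProduct, dotProduct_add, smul_dotProduct,
        dotProduct_smul, hdd, hxd, smul_eq_mul]
      ring
    rw [this, hdx]
    nlinarith [mul_nonneg (hx v) (sub_nonneg.2 hle)]

lemma walk_sum_aux (A : Matrix V V ℝ) : ∀ (k : ℕ) (g : V → ℝ),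
    ∑ f : Fin (k + 1) → V, g (f 0) * ∏ i : Fin k, A (f i.castSucc) (f i.succ)
      = ∑ i, ∑ j, g i * (A ^ k) i j := by
  intro k
  induction k with
  | zero =>
    intro g
    rw [← (Fin.consEquiv (fun _ : Fin 1 => V)).sum_comp, Fintype.sum_prod_type]
    simp [Fin.consEquiv, Matrix.one_apply]
  | succ k ih =>
    intro g
    rw [← (Fin.consEquiv (fun _ : Fin (k + 2) => V)).sum_comp, Fintype.sum_prod_type,
      Finset.sum_comm]
    have h1 : ∀ f : Fin (k + 1) → V, (∑ a, g ((Fin.consEquiv (fun _ : Fin (k + 2) => V)) (a, f) 0) *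
        ∏ i : Fin (k + 1), A ((Fin.consEquiv (fun _ : Fin (k + 2) => V)) (a, f) i.castSucc)
          ((Fin.consEquiv (fun _ : Fin (k + 2) => V)) (a, f) i.succ))
        = (∑ a, g a * A a (f 0)) * ∏ i : Fin k, A (f i.castSucc) (f i.succ) := by
      intro f
      rw [Finset.sum_mul]
      refine Finset.sum_congr rfl fun a _ => ?_
      rw [Fin.prod_univ_succ]
      simp only [Fin.consEquiv_apply, Fin.cons_zero, Fin.cons_succ, Fin.castSucc_zero,
        ← Fin.succ_castSucc, mul_assoc]
    rw [Finset.sum_congr rfl fun f _ => h1 f, ih (fun b => ∑ a, g a * A a b)]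
    simp only [pow_succ', Matrix.mul_apply, Finset.mul_sum, Finset.sum_mul]
    rw [Finset.sum_congr rfl fun b _ => Finset.sum_comm, Finset.sum_comm]
    refine Finset.sum_congr rfl fun a _ => ?_
    rw [Finset.sum_comm]
    refine Finset.sum_congr rfl fun b _ => Finset.sum_congr rfl fun c _ => ?_
    ring

lemma walkCount_eq_aux (G : SimpleGraph V) [DecidableRel G.Adj] (k : ℕ) :
    (walkCount G (k + 1) : ℝ) = ∑ i, ∑ j, (G.adjMatrix ℝ ^ k) i j := by
  have h := walk_sum_aux (G.adjMatrix ℝ) k (fun _ => 1)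
  simp only [one_mul] at h
  rw [← h]
  classical
  have h2 : ∀ f : Fin (k + 1) → V, ∏ i : Fin k, G.adjMatrix ℝ (f i.castSucc) (f i.succ)
      = if (∀ (i : ℕ) (h : i + 1 < k + 1),
          G.Adj (f ⟨i, Nat.lt_of_succ_lt h⟩) (f ⟨i + 1, h⟩)) then 1 else 0 := by
    intro f
    simp only [SimpleGraph.adjMatrix_apply]
    rw [Finset.prod_ite_zero]
    simp only [Finset.prod_const_one]
    refine if_congr ?_ rfl rfl
    constructor
    · intro H i hi
      exact H ⟨i, by omega⟩ (Finset.mem_univ _)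
    · intro H i _
      exact H i.1 (by omega)
  simp only [h2, walkCount, Nat.card_eq_fintype_card, Fintype.card_subtype, Finset.sum_boole]

lemma perron_aux (G : SimpleGraph V) [DecidableRel G.Adj] (hedge : ∃ u v, G.Adj u v) :
    0 < adjSpectralRadius G ∧ ∃ x : V → ℝ, (∀ i, 0 ≤ x i) ∧ ∑ i, x i ^ 2 = 1 ∧
      G.adjMatrix ℝ *ᵥ x = adjSpectralRadius G • x := by
  obtain ⟨u, v, huv⟩ := hedge
  have : Nonempty V := ⟨u⟩
  have hA := adjMatrix_isHermitian G
  set m := adjSpectralRadius G with hm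
  have hP : (algebraMap ℝ (Matrix V V ℝ) m - G.adjMatrix ℝ).PosSemidef := by
    rw [Matrix.posSemidef_iff_isHermitian_and_spectrum_nonneg]
    constructor
    · refine Matrix.IsHermitian.sub ?_ hA
      rw [Matrix.algebraMap_eq_diagonal]
      exact Matrix.isHermitian_diagonal _
    · rw [← spectrum.singleton_sub_eq, hA.spectrum_real_eq_range_eigenvalues]
      rintro _ ⟨a, ha, _, ⟨i, rfl⟩, rfl⟩
      rw [Set.mem_singleton_iff] at ha
      subst ha
      simp only [Set.mem_ofPred_eq, sub_nonneg]
      exact le_ciSup (f := hA.eigenvalues) (Set.finite_range _).bddAbove i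
  have hmul : ∀ x : V → ℝ, (algebraMap ℝ (Matrix V V ℝ) m - G.adjMatrix ℝ) *ᵥ x
      = m • x - G.adjMatrix ℝ *ᵥ x := by
    intro x
    rw [sub_mulVec, Algebra.algebraMap_eq_smul_one, smul_mulVec, one_mulVec]
  have hray : ∀ x : V → ℝ, x ⬝ᵥ (G.adjMatrix ℝ *ᵥ x) ≤ m * (x ⬝ᵥ x) := by
    intro x
    have := hP.dotProduct_mulVec_nonneg x
    rw [hmul, dotProduct_sub, dotProduct_smul, star_trivial, smul_eq_mul] at this
    linarith
  constructor
  · have h1 := hray (Pi.single u 1 + Pi.single v 1)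
    have hne := huv.ne
    simp [mulVec_add, add_dotProduct, huv, huv.symm, hne, hne.symm] at h1
    by_contra hcon
    linarith
  · obtain ⟨i, hi⟩ := exists_eq_ciSup_of_finite (f := hA.eigenvalues)
    have hi' : hA.eigenvalues i = m := hi
    set z : V → ℝ := (hA.eigenvectorBasis i).ofLp with hz
    have hez : G.adjMatrix ℝ *ᵥ z = m • z := by
      rw [hz, hA.mulVec_eigenvectorBasis, hi']
    have hz1 : ∑ j, z j ^ 2 = 1 := by
      have := hA.eigenvectorBasis.orthonormal.1 i
      rw [EuclideanSpace.norm_eq, Real.sqrt_eq_one] at this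
      simpa using this
    refine ⟨fun j => |z j|, fun j => abs_nonneg _, by simpa using hz1, ?_⟩
    set x : V → ℝ := fun j => |z j| with hx
    have hxx : x ⬝ᵥ x = 1 := by
      simp only [dotProduct, hx, ← sq, sq_abs, hz1]
    have hzz : z ⬝ᵥ (G.adjMatrix ℝ *ᵥ z) = m := by
      rw [hez, dotProduct_smul]
      simp only [dotProduct, ← sq, hz1, smul_eq_mul, mul_one]
    have hge : z ⬝ᵥ (G.adjMatrix ℝ *ᵥ z) ≤ x ⬝ᵥ (G.adjMatrix ℝ *ᵥ x) := by
      simp only [dotProduct, mulVec, Finset.mul_sum]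
      refine Finset.sum_le_sum fun a _ => Finset.sum_le_sum fun b _ => ?_
      have hab : 0 ≤ G.adjMatrix ℝ a b := by
        rw [SimpleGraph.adjMatrix_apply]; split_ifs <;> norm_num
      have h3 : z a * z b ≤ x a * x b := by
        simp only [hx, ← abs_mul]; exact le_abs_self _
      nlinarith [mul_le_mul_of_nonneg_left h3 hab]
    have h0 : star x ⬝ᵥ ((algebraMap ℝ (Matrix V V ℝ) m - G.adjMatrix ℝ) *ᵥ x) = 0 := by
      have := hray x
      rw [hmul, dotProduct_sub, dotProduct_smul, star_trivial, smul_eq_mul, hxx]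
      rw [hxx] at this
      linarith
    rw [hP.dotProduct_mulVec_zero_iff, hmul, sub_eq_zero] at h0
    exact h0.symm

end Helpers

/-- **Nikiforov (2006).** For every graph `G` with at least one edge and every `s ≥ 1`,
`μ(G)^s ≤ ((ω(G)−1)/ω(G)) · w_s(G)`. -/
theorem spectral_radius_pow_le_walkCount {V : Type*} [Fintype V] [DecidableEq V]
    (G : SimpleGraph V) [DecidableRel G.Adj] (hedge : ∃ u v, G.Adj u v)
    (s : ℕ) (hs : 1 ≤ s) :
    adjSpectralRadius G ^ s ≤
      (((G.cliqueNum : ℝ) - 1) / (G.cliqueNum : ℝ)) * walkCount G s := by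
  obtain ⟨hm, x, hx, hx1, hex⟩ := perron_aux G hedge
  set m := adjSpectralRadius G with hmdef
  have hpos : 0 < G.cliqueNum := by
    obtain ⟨u, -, -⟩ := hedge
    have : ({u} : Finset V).card ≤ G.cliqueNum :=
      SimpleGraph.IsClique.card_le_cliqueNum (tc := by simp)
    rw [Finset.card_singleton] at this
    exact this
  have hA0 : ∀ i j, 0 ≤ G.adjMatrix ℝ i j := fun i j => by
    rw [SimpleGraph.adjMatrix_apply]; split_ifs <;> norm_num
  have hAs : ∀ i j, G.adjMatrix ℝ i j = G.adjMatrix ℝ j i := fun i j => by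
    simp [SimpleGraph.adjMatrix_apply, G.adj_comm]
  obtain ⟨k, rfl⟩ : ∃ k, s = k + 1 := ⟨s - 1, by omega⟩
  have hpow : ∀ k : ℕ, (G.adjMatrix ℝ ^ k).mulVec x = m ^ k • x := by
    intro k
    induction k with
    | zero => simp
    | succ k ih =>
      rw [pow_succ', ← Matrix.mulVec_mulVec, ih, Matrix.mulVec_smul, hex, smul_smul, pow_succ]
  have hpow0 : ∀ (k : ℕ) (i j : V), 0 ≤ (G.adjMatrix ℝ ^ k) i j := by
    intro k
    induction k with
    | zero => intro i j; rw [pow_zero, Matrix.one_apply]; split_ifs <;> norm_num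
    | succ k ih =>
      intro i j
      rw [pow_succ, Matrix.mul_apply]
      exact Finset.sum_nonneg fun l _ => mul_nonneg (ih _ _) (hA0 _ _)
  have hpows : ∀ i j, (G.adjMatrix ℝ ^ k) i j = (G.adjMatrix ℝ ^ k) j i := by
    intro i j
    have h : (G.adjMatrix ℝ ^ k).transpose = G.adjMatrix ℝ ^ k := by
      rw [Matrix.transpose_pow, SimpleGraph.transpose_adjMatrix]
    exact congrFun (congrFun h j) i
  set S := ∑ i, x i ^ 2 * Real.log (x i) with hS
  have hW := jensen_aux (fun i j => (G.adjMatrix ℝ ^ k) i j) (hpow0 k) hpows x hx hx1 (m ^ k)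
    (pow_pos hm k) (fun i => congrFun (hpow k) i) (-1)
  have hB := jensen_aux (fun i j => G.adjMatrix ℝ i j) hA0 hAs x hx hx1 m hm
    (fun i => congrFun hex i) 1
  have hexp : ∀ i, x i ≠ 0 → Real.exp (Real.log (x i)) = x i :=
    fun i hi => Real.exp_log (lt_of_le_of_ne (hx i) hi.symm)
  have hW' : m ^ k * Real.exp (-1 * (2 * S)) ≤ walkCount G (k + 1) := by
    refine hW.trans ?_
    rw [walkCount_eq_aux]
    refine Finset.sum_le_sum fun i _ => Finset.sum_le_sum fun j _ => ?_
    by_cases hi : x i = 0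
    · simpa [hi] using hpow0 k i j
    by_cases hj : x j = 0
    · simpa [hj] using hpow0 k i j
    rw [neg_one_mul, Real.exp_neg, Real.exp_add, hexp i hi, hexp j hj]
    apply le_of_eq
    field_simp
  have hMS := motzkin_straus_aux G hpos _ (fun i => x i ^ 2) (fun i => sq_nonneg _) hx1 rfl
  have hB' : m * Real.exp (1 * (2 * S)) ≤ ((G.cliqueNum : ℝ) - 1) / G.cliqueNum := by
    refine (hB.trans (le_of_eq ?_)).trans hMS
    simp only [dotProduct, Matrix.mulVec, Finset.mul_sum]
    refine Finset.sum_congr rfl fun i _ => Finset.sum_congr rfl fun j _ => ?_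
    by_cases hi : x i = 0
    · simp [hi]
    by_cases hj : x j = 0
    · simp [hj]
    rw [one_mul, Real.exp_add, hexp i hi, hexp j hj]
    ring
  have hmul := mul_le_mul hB' hW' (by positivity)
    (le_trans (mul_nonneg hm.le (Real.exp_pos _).le) hB')
  refine le_trans (le_of_eq ?_) hmul
  have : Real.exp (1 * (2 * S)) * Real.exp (-1 * (2 * S)) = 1 := by
    rw [← Real.exp_add]; simp
  calc m ^ (k + 1) = m * m ^ k * (Real.exp (1 * (2 * S)) * Real.exp (-1 * (2 * S))) := by
        rw [this]; ring
    _ = _ := by ring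
end

section
/- For every finite simple graph G and all integers r ≥ 2 and l ≥ 2, the number of walks satisfies w_{l+r}(G) ≤ (r+1)·k_{r+1}(G)·w_{l−1}(G) + Σ_{s=2}^{r} (s−1)·k_s(G)·w_{l+r−s}(G). -/
open Finset

/-- Number of walks with `n + 1` vertices starting at `x`, recursively. -/
def recWalk {V : Type*} [Fintype V] (G : SimpleGraph V) [DecidableRel G.Adj] : ℕ → V → ℕ
  | 0, _ => 1
  | n + 1, x => ∑ y, if G.Adj x y then recWalk G n y else 0

lemma walkCountFrom_eq {V : Type*} [Fintype V]
    (G : SimpleGraph V) [DecidableRel G.Adj] (n : ℕ) (x : V) :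
    walkCountFrom G x (n + 1) = recWalk G n x := by
  induction n generalizing x with
  | zero =>
    unfold walkCountFrom recWalk
    rw [Nat.card_eq_one_iff_unique]
    refine ⟨⟨?_⟩, ⟨⟨fun _ => x, fun _ => rfl, fun i h => by omega⟩⟩⟩
    rintro ⟨f, hf, _⟩ ⟨g, hg, _⟩
    apply Subtype.ext
    funext i
    have hi : i = ⟨0, Nat.one_pos⟩ := by ext; have := i.2; simp only; omega
    rw [hi]
    exact (hf _).trans (hg _).symm
  | succ n ih =>
    have e : {f : Fin (n + 1 + 1) → V // (∀ (h : 0 < n + 1 + 1), f ⟨0, h⟩ = x) ∧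
        ∀ (i : ℕ) (h : i + 1 < n + 1 + 1), G.Adj (f ⟨i, Nat.lt_of_succ_lt h⟩) (f ⟨i + 1, h⟩)} ≃
        (Σ y : {y // G.Adj x y}, {f : Fin (n + 1) → V // (∀ (h : 0 < n + 1), f ⟨0, h⟩ = y.1) ∧
        ∀ (i : ℕ) (h : i + 1 < n + 1), G.Adj (f ⟨i, Nat.lt_of_succ_lt h⟩) (f ⟨i + 1, h⟩)}) :=
      { toFun := fun f => ⟨⟨f.1 ⟨1, by omega⟩, by
            have h0 := f.2.1 (by omega)
            have h1 := f.2.2 0 (by omega)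
            rw [h0] at h1
            exact h1⟩,
          ⟨fun i => f.1 i.succ, fun h => rfl, fun i h => f.2.2 (i + 1) (by omega)⟩⟩
        invFun := fun p => ⟨Fin.cons x p.2.1, fun h => rfl, fun i h => by
            cases i with
            | zero =>
              have h0 := p.2.2.1 (by omega)
              have h1 := p.1.2
              rw [← h0] at h1
              exact h1
            | succ i => exact p.2.2.2 i (by omega)⟩
        left_inv := by
          rintro ⟨f, hf, hf2⟩
          apply Subtype.ext
          funext i
          refine Fin.cases ?_ (fun j => ?_) i
          · exact (hf (by omega)).symm
          · rfl
        right_inv := by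
          rintro ⟨⟨y, hy⟩, ⟨f, hf, hf2⟩⟩
          have : f ⟨0, by omega⟩ = y := hf (by omega)
          subst this
          rfl }
    have h1 : walkCountFrom G x (n + 1 + 1) =
        ∑ y : {y // G.Adj x y}, walkCountFrom G y.1 (n + 1) := by
      unfold walkCountFrom
      rw [Nat.card_congr e, Nat.card_sigma]
    rw [h1, recWalk, ← Finset.sum_filter]
    simp_rw [ih]
    exact (Finset.sum_subtype _ (by simp) _).symm

lemma walkCount_eq {V : Type*} [Fintype V]
    (G : SimpleGraph V) [DecidableRel G.Adj] (n : ℕ) :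
    walkCount G (n + 1) = ∑ x, recWalk G n x := by
  have e : {f : Fin (n + 1) → V //
        ∀ (i : ℕ) (h : i + 1 < n + 1), G.Adj (f ⟨i, Nat.lt_of_succ_lt h⟩) (f ⟨i + 1, h⟩)} ≃
        (Σ y : V, {f : Fin (n + 1) → V // (∀ (h : 0 < n + 1), f ⟨0, h⟩ = y) ∧
        ∀ (i : ℕ) (h : i + 1 < n + 1), G.Adj (f ⟨i, Nat.lt_of_succ_lt h⟩) (f ⟨i + 1, h⟩)}) :=
      { toFun := fun f => ⟨f.1 ⟨0, by omega⟩, ⟨f.1, fun _ => rfl, f.2⟩⟩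
        invFun := fun p => ⟨p.2.1, p.2.2.2⟩
        left_inv := fun f => rfl
        right_inv := by
          rintro ⟨y, ⟨f, hf, hf2⟩⟩
          have : f ⟨0, by omega⟩ = y := hf (by omega)
          subst this
          rfl }
  have h1 : walkCount G (n + 1) = ∑ y : V, walkCountFrom G y (n + 1) := by
    unfold walkCount walkCountFrom
    rw [Nat.card_congr e, Nat.card_sigma]
  rw [h1]
  simp_rw [walkCountFrom_eq]

/-- Weighted count of `s`-cliques: sum over cliques and over their vertices. -/
def cliqueSum {V : Type*} [Fintype V] [DecidableEq V]
    (G : SimpleGraph V) [DecidableRel G.Adj] (s n : ℕ) : ℕ :=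
  ∑ K ∈ G.cliqueFinset s, ∑ v ∈ K, recWalk G n v

lemma extend_sum {V : Type*} [Fintype V] [DecidableEq V]
    (G : SimpleGraph V) [DecidableRel G.Adj] (s : ℕ) (w : V → ℕ) :
    ∑ K ∈ G.cliqueFinset s, ∑ x, (if ∀ v ∈ K, G.Adj v x then w x else 0) =
      ∑ K ∈ G.cliqueFinset (s + 1), ∑ v ∈ K, w v := by
  simp_rw [← Finset.sum_filter]
  rw [Finset.sum_sigma', Finset.sum_sigma']
  refine Finset.sum_bij' (fun p _ => ⟨insert p.2 p.1, p.2⟩) (fun p _ => ⟨p.1.erase p.2, p.2⟩)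
    ?_ ?_ ?_ ?_ ?_
  · rintro ⟨K, x⟩ h
    simp only [Finset.mem_sigma, SimpleGraph.mem_cliqueFinset_iff, Finset.mem_filter,
      Finset.mem_univ, true_and] at h ⊢
    exact ⟨h.1.insert fun b hb => (h.2 b hb).symm, Finset.mem_insert_self _ _⟩
  · rintro ⟨K, x⟩ h
    simp only [Finset.mem_sigma, SimpleGraph.mem_cliqueFinset_iff, Finset.mem_filter,
      Finset.mem_univ, true_and] at h ⊢
    refine ⟨⟨h.1.1.subset (by simp), ?_⟩, ?_⟩
    · rw [Finset.card_erase_of_mem h.2, h.1.2]; rfl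
    · intro v hv
      rw [Finset.mem_erase] at hv
      exact h.1.1 hv.2 h.2 hv.1
  · rintro ⟨K, x⟩ h
    simp only [Finset.mem_sigma, SimpleGraph.mem_cliqueFinset_iff, Finset.mem_filter,
      Finset.mem_univ, true_and] at h ⊢
    have : x ∉ K := fun hx => G.loopless.irrefl x (h.2 x hx)
    rw [Finset.erase_insert this]
  · rintro ⟨K, x⟩ h
    simp only [Finset.mem_sigma] at h ⊢
    rw [Finset.insert_erase h.2]
  · rintro ⟨K, x⟩ h
    rfl

lemma cliqueSum_step {V : Type*} [Fintype V] [DecidableEq V]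
    (G : SimpleGraph V) [DecidableRel G.Adj] (s n : ℕ) :
    cliqueSum G s (n + 1) ≤
      (s - 1) * cliqueCount G s * walkCount G (n + 1) + cliqueSum G (s + 1) n := by
  have key : ∀ K ∈ G.cliqueFinset s, ∑ v ∈ K, recWalk G (n + 1) v ≤
      (s - 1) * walkCount G (n + 1) +
        ∑ x, (if ∀ v ∈ K, G.Adj v x then recWalk G n x else 0) := by
    intro K hK
    rw [SimpleGraph.mem_cliqueFinset_iff] at hK
    simp only [recWalk]
    rw [Finset.sum_comm, walkCount_eq, Finset.mul_sum, ← Finset.sum_add_distrib]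
    refine Finset.sum_le_sum fun x _ => ?_
    rw [← Finset.sum_filter, Finset.sum_const, smul_eq_mul]
    split_ifs with h
    · have hc : (K.filter fun v => G.Adj v x).card ≤ s - 1 + 1 :=
        (Finset.card_filter_le _ _).trans (by rw [hK.2]; omega)
      nlinarith [Nat.mul_le_mul_right (recWalk G n x) hc]
    · have hlt : (K.filter fun v => G.Adj v x).card < K.card := by
        apply Finset.card_lt_card
        rw [Finset.filter_ssubset]
        push Not at h
        exact h
      rw [hK.2] at hlt
      rw [add_zero]
      exact Nat.mul_le_mul_right _ (by omega)
  calc cliqueSum G s (n + 1) ≤ _ := Finset.sum_le_sum key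
    _ = _ := by
      rw [Finset.sum_add_distrib, extend_sum, Finset.sum_const, smul_eq_mul]
      unfold cliqueCount cliqueSum
      ring

lemma walkCount_eq_cliqueSum {V : Type*} [Fintype V] [DecidableEq V]
    (G : SimpleGraph V) [DecidableRel G.Adj] (n : ℕ) :
    walkCount G (n + 1) = cliqueSum G 1 n := by
  have h := extend_sum G 0 (recWalk G n)
  have h0 : G.cliqueFinset 0 = {∅} := by
    ext K
    simp [SimpleGraph.mem_cliqueFinset_iff]
  rw [h0] at h
  rw [walkCount_eq]
  simpa [cliqueSum] using h

lemma walkCount_le_aux {V : Type*} [Fintype V] [DecidableEq V]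
    (G : SimpleGraph V) [DecidableRel G.Adj] (r m : ℕ) :
    walkCount G (m + 1 + (r + 1)) ≤ cliqueSum G (r + 2) m +
        ∑ s ∈ Finset.Icc 2 (r + 1), (s - 1) * cliqueCount G s * walkCount G (m + 1 + (r + 1) - s) := by
  induction r generalizing m with
  | zero =>
    have h := cliqueSum_step G 1 m
    rw [← walkCount_eq_cliqueSum] at h
    simpa using h
  | succ r ih =>
    have h := ih (m + 1)
    have h2 := cliqueSum_step G (r + 2) m
    rw [Finset.sum_Icc_succ_top (by omega)]
    have e1 : m + 1 + (r + 1 + 1) = m + 1 + 1 + (r + 1) := by omega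
    have e2 : m + 1 + 1 + (r + 1) - (r + 1 + 1) = m + 1 := by omega
    rw [e1, e2]
    have e3 : r + 1 + 1 = r + 2 := rfl
    rw [e3]
    have e4 : r + 1 + 2 = r + 2 + 1 := by omega
    rw [e4]
    linarith

/-- For every graph `G` and integers `r ≥ 2`, `l ≥ 2`,
`w_{l+r}(G) ≤ (r+1)·k_{r+1}(G)·w_{l−1}(G) + ∑_{s=2}^{r} (s−1)·k_s(G)·w_{l+r−s}(G)`. -/
theorem walkCount_add_le {V : Type*} [Fintype V] [DecidableEq V]
    (G : SimpleGraph V) [DecidableRel G.Adj] (r l : ℕ) (hr : 2 ≤ r) (hl : 2 ≤ l) :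
    walkCount G (l + r) ≤
      (r + 1) * cliqueCount G (r + 1) * walkCount G (l - 1) +
        ∑ s ∈ Finset.Icc 2 r, (s - 1) * cliqueCount G s * walkCount G (l + r - s) := by
  obtain ⟨m, rfl⟩ : ∃ m, l = m + 1 + 1 := ⟨l - 2, by omega⟩
  obtain ⟨q, rfl⟩ : ∃ q, r = q + 1 := ⟨r - 1, by omega⟩
  refine (walkCount_le_aux G q (m + 1)).trans (Nat.add_le_add_right ?_ _)
  have hb : ∀ v, recWalk G (m + 1) v ≤ walkCount G (m + 1) := by
    intro v
    rw [walkCount_eq, recWalk]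
    refine Finset.sum_le_sum fun y _ => ?_
    split_ifs <;> simp
  unfold cliqueSum
  calc _ ≤ ∑ K ∈ G.cliqueFinset (q + 2), (q + 2) * walkCount G (m + 1) := by
        refine Finset.sum_le_sum fun K hK => ?_
        rw [SimpleGraph.mem_cliqueFinset_iff] at hK
        refine (Finset.sum_le_card_nsmul _ _ _ fun v _ => hb v).trans ?_
        rw [hK.2, smul_eq_mul]
    _ = _ := by
        rw [Finset.sum_const, smul_eq_mul]
        unfold cliqueCount
        simp only [Nat.add_sub_cancel]
        ring
end

section
/- Let G be a finite simple connected graph that is not bipartite. Then for every fixed integer q ≥ 0, the ratio w_{l+q}(G)/w_{l−1}(G) tends to μ(G)^{q+1} as l → ∞. -/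
open Finset

open Matrix in
lemma sum_walks_aux {V : Type*} [Fintype V] [DecidableEq V] (A : Matrix V V ℝ) (k : ℕ) :
    ∀ x : V → ℝ, ∑ f : Fin (k + 1) → V, x (f 0) * ∏ i : Fin k, A (f i.castSucc) (f i.succ)
      = x ⬝ᵥ ((A ^ k) *ᵥ 1) := by
  induction k with
  | zero =>
    intro x
    rw [← (Equiv.funUnique (Fin 1) V).symm.sum_comp]
    simp [dotProduct]
  | succ k ih =>
    intro x
    rw [pow_succ', ← Matrix.mulVec_mulVec, Matrix.dotProduct_mulVec, ← ih,
      ← (Fin.consEquiv (fun _ : Fin (k + 2) => V)).sum_comp, Fintype.sum_prod_type,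
      Finset.sum_comm]
    refine Finset.sum_congr rfl fun g _ => ?_
    simp only [Fin.consEquiv, Equiv.coe_fn_mk, Fin.prod_univ_succ, Fin.cons_zero, Fin.cons_succ,
      Fin.castSucc_zero, ← Fin.succ_castSucc]
    simp only [vecMul, dotProduct, Finset.sum_mul]
    refine Finset.sum_congr rfl fun a _ => ?_
    ring

open Matrix in
lemma walkCount_succ_eq {V : Type*} [Fintype V] [DecidableEq V] (G : SimpleGraph V)
    [DecidableRel G.Adj] (k : ℕ) :
    (walkCount G (k + 1) : ℝ) = (1 : V → ℝ) ⬝ᵥ ((G.adjMatrix ℝ ^ k) *ᵥ 1) := by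
  classical
  rw [← sum_walks_aux]
  simp only [SimpleGraph.adjMatrix_apply, Finset.prod_boole, Pi.one_apply, one_mul]
  rw [walkCount, Nat.card_eq_fintype_card, Fintype.card_subtype, ← Finset.sum_boole]
  refine Finset.sum_congr rfl fun f _ => ?_
  have hiff : (∀ (i : ℕ) (h : i + 1 < k + 1),
      G.Adj (f ⟨i, Nat.lt_of_succ_lt h⟩) (f ⟨i + 1, h⟩)) ↔
      ∀ i ∈ (Finset.univ : Finset (Fin k)), G.Adj (f i.castSucc) (f i.succ) :=
    ⟨fun h i _ => h i.1 (by omega), fun h i hi => h ⟨i, by omega⟩ (Finset.mem_univ _)⟩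
  split_ifs with h1 h2 h2
  · rfl
  · exact absurd (hiff.1 h1) h2
  · exact absurd (hiff.2 h2) h1
  · rfl

open Matrix in
lemma exists_eigen_sys {V : Type*} [Fintype V] [DecidableEq V] {A : Matrix V V ℝ}
    (hA : A.IsHermitian) : ∃ b : V → V → ℝ, (∀ i, A *ᵥ b i = hA.eigenvalues i • b i) ∧
      (∀ x y : V → ℝ, ∑ i, (x ⬝ᵥ b i) * (b i ⬝ᵥ y) = x ⬝ᵥ y) ∧ (∀ i, b i ⬝ᵥ b i = 1) := by
  refine ⟨fun i => (hA.eigenvectorBasis i).ofLp, fun i => hA.mulVec_eigenvectorBasis i, ?_, ?_⟩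
  · intro x y
    have := hA.eigenvectorBasis.sum_inner_mul_inner (WithLp.toLp 2 x) (WithLp.toLp 2 y)
    simp only [EuclideanSpace.inner_eq_star_dotProduct, star_trivial] at this
    rw [dotProduct_comm x y, ← this]
    refine Finset.sum_congr rfl fun i _ => ?_
    rw [dotProduct_comm x, dotProduct_comm _ y]
  · intro i
    have := hA.eigenvectorBasis.inner_eq_one i
    simpa only [EuclideanSpace.inner_eq_star_dotProduct, star_trivial] using this

open Matrix in
lemma eigen_pow {V : Type*} [Fintype V] [DecidableEq V] {A : Matrix V V ℝ}
    {v : V → ℝ} {r : ℝ} (h : A *ᵥ v = r • v) (k : ℕ) : (A ^ k) *ᵥ v = r ^ k • v := by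
  induction k with
  | zero => simp
  | succ k ih => rw [pow_succ, ← mulVec_mulVec, h, mulVec_smul, ih, smul_smul, pow_succ']

open Matrix in
lemma symm_dot {V : Type*} [Fintype V] {A : Matrix V V ℝ}
    (hA : Aᵀ = A) (x y : V → ℝ) : x ⬝ᵥ (A *ᵥ y) = (A *ᵥ x) ⬝ᵥ y := by
  rw [dotProduct_mulVec, ← mulVec_transpose, hA]

open Matrix in
lemma quad_eq {V : Type*} [Fintype V] (A : Matrix V V ℝ) (x y : V → ℝ) :
    x ⬝ᵥ (A *ᵥ y) = ∑ u, ∑ v, A u v * (x u * y v) := by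
  simp only [dotProduct, mulVec, Finset.mul_sum]
  refine Finset.sum_congr rfl fun u _ => Finset.sum_congr rfl fun v _ => by ring

open Matrix in
/-- The whole Perron-Frobenius information needed. -/
lemma perron_info {V : Type*} [Fintype V] [DecidableEq V]
    (G : SimpleGraph V) [DecidableRel G.Adj]
    (hconn : G.Connected) (hnb : ¬ G.Colorable 2) :
    ∃ (c l : V → ℝ) (m : ℝ), m = adjSpectralRadius G ∧ 0 < m ∧ (∀ i, 0 ≤ c i) ∧
      (∀ k, (walkCount G (k + 1) : ℝ) = ∑ i, c i * l i ^ k) ∧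
      (∀ i, l i ≠ m → |l i| < m) ∧ ∃ i, l i = m ∧ 0 < c i := by
  classical
  have : Nonempty V := hconn.nonempty
  set A := G.adjMatrix ℝ with hAdef
  have hAsymm : Aᵀ = A := SimpleGraph.isSymm_adjMatrix G
  have hA0 : ∀ u v, 0 ≤ A u v := fun u v => by
    rw [hAdef, SimpleGraph.adjMatrix_apply]; split_ifs <;> norm_num
  obtain ⟨b, hb, hsum, hnorm⟩ := exists_eigen_sys (adjMatrix_isHermitian G)
  set l := (adjMatrix_isHermitian G).eigenvalues with hl
  set m := adjSpectralRadius G with hm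
  have hle : ∀ i, l i ≤ m := fun i => le_ciSup (Set.finite_range _).bddAbove i
  obtain ⟨i0, hi0⟩ : ∃ i, l i = m := exists_eq_ciSup_of_finite
  -- quadratic form in eigen coordinates
  have hquad : ∀ x y k, x ⬝ᵥ ((A ^ k) *ᵥ y) = ∑ i, l i ^ k * ((x ⬝ᵥ b i) * (b i ⬝ᵥ y)) := by
    intro x y k
    rw [← hsum]
    refine Finset.sum_congr rfl fun i _ => ?_
    rw [symm_dot (by rw [transpose_pow, hAsymm]), eigen_pow (hb i), smul_dotProduct, smul_eq_mul]
    ring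
  have hquad1 : ∀ x, m * (x ⬝ᵥ x) - x ⬝ᵥ (A *ᵥ x) = ∑ i, (m - l i) * (x ⬝ᵥ b i) ^ 2 := by
    intro x
    have h1 := hquad x x 1
    rw [pow_one] at h1
    rw [h1, ← hsum x x, Finset.mul_sum, ← Finset.sum_sub_distrib]
    refine Finset.sum_congr rfl fun i _ => ?_
    rw [dotProduct_comm (b i) x]; ring
  have habsq : ∀ x : V → ℝ, |x| ⬝ᵥ |x| = x ⬝ᵥ x := fun x => by
    simp [dotProduct, Pi.abs_apply]
  have hterm : ∀ (x : V → ℝ) u v, |A u v * (x u * x v)| = A u v * (|x| u * |x| v) := by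
    intro x u v
    rw [abs_mul, abs_mul, abs_of_nonneg (hA0 u v)]; rfl
  have habs : ∀ x : V → ℝ, |x ⬝ᵥ (A *ᵥ x)| ≤ |x| ⬝ᵥ (A *ᵥ |x|) := by
    intro x
    rw [quad_eq, quad_eq]
    refine (Finset.abs_sum_le_sum_abs _ _).trans (Finset.sum_le_sum fun u _ => ?_)
    refine (Finset.abs_sum_le_sum_abs _ _).trans (Finset.sum_le_sum fun v _ => ?_)
    exact (hterm x u v).le
  have hray : ∀ x, x ⬝ᵥ (A *ᵥ x) ≤ m * (x ⬝ᵥ x) := by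
    intro x
    have : 0 ≤ ∑ i, (m - l i) * (x ⬝ᵥ b i) ^ 2 :=
      Finset.sum_nonneg fun i _ => mul_nonneg (sub_nonneg.2 (hle i)) (sq_nonneg _)
    rw [← hquad1] at this; linarith
  have hself : ∀ i, b i ⬝ᵥ (A *ᵥ b i) = l i := fun i => by
    rw [hb, dotProduct_smul, hnorm, smul_eq_mul, mul_one]
  have habsle : ∀ i, |l i| ≤ m := by
    intro i
    have h1 := habs (b i)
    have h2 := hray |b i|
    rw [habsq, hnorm, mul_one] at h2
    rw [hself] at h1
    linarith
  -- extremal eigenvectors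
  have hext : ∀ i, |l i| = m → |b i| ⬝ᵥ (A *ᵥ |b i|) = m ∧
      ∀ j, l j ≠ m → |b i| ⬝ᵥ b j = 0 := by
    intro i hi
    have h1 := habs (b i)
    have h2 := hray |b i|
    rw [habsq, hnorm, mul_one] at h2
    rw [hself, hi] at h1
    have h3 := le_antisymm h2 h1
    refine ⟨h3, fun j hj => ?_⟩
    have h4 := hquad1 |b i|
    rw [habsq, hnorm, mul_one, h3, sub_self] at h4
    have h5 := (Finset.sum_eq_zero_iff_of_nonneg (fun k _ =>
      mul_nonneg (sub_nonneg.2 (hle k)) (sq_nonneg _))).1 h4.symm j (Finset.mem_univ j)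
    rcases mul_eq_zero.1 h5 with h6 | h6
    · exact absurd (by linarith) hj
    · exact pow_eq_zero_iff (two_ne_zero) |>.1 h6
  have hneg : ∀ i, l i ≠ -m := by
    intro i hi
    have hm0 : 0 ≤ m := (abs_nonneg _).trans (habsle i)
    obtain ⟨h3, h4⟩ := hext i (by rw [hi, abs_neg, abs_of_nonneg hm0])
    set y := |b i| with hy
    have hy0 : ∀ u, 0 ≤ y u := fun u => abs_nonneg (b i u)
    -- A y = m y
    have hev : A *ᵥ y = m • y := by
      have key : ∀ z : V → ℝ, z ⬝ᵥ (A *ᵥ y) = z ⬝ᵥ (m • y) := by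
        intro z
        have h1 := hquad z y 1
        rw [pow_one] at h1
        rw [h1, dotProduct_smul, ← hsum z y, smul_eq_mul, Finset.mul_sum]
        refine Finset.sum_congr rfl fun j _ => ?_
        by_cases hj : l j = m
        · rw [hj, pow_one]
        · rw [dotProduct_comm (b j) y, h4 j hj]; ring
      ext u
      simpa using key (Pi.single u 1)
    have hstep : ∀ u v, G.Adj u v → y u = 0 → y v = 0 := by
      intro u v huv hu
      have h5 := congrFun hev u
      rw [Pi.smul_apply, hu, smul_zero, mulVec, dotProduct] at h5
      have h6 := (Finset.sum_eq_zero_iff_of_nonneg (fun w _ =>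
        mul_nonneg (hA0 u w) (hy0 w))).1 h5 v (Finset.mem_univ v)
      simpa [hAdef, SimpleGraph.adjMatrix_apply, huv] using h6
    have hreach : ∀ u v, G.Walk u v → y u = 0 → y v = 0 := by
      intro u v p
      induction p with
      | nil => exact id
      | cons h p ih => exact fun hu => ih (hstep _ _ h hu)
    have hpos : ∀ u, b i u ≠ 0 := by
      intro u hu
      have : ∀ v, b i v = 0 := fun v => by
        obtain ⟨p⟩ := hconn.preconnected u v
        have := hreach u v p (by simp [hy, Pi.abs_apply, hu])
        simpa [hy, Pi.abs_apply] using this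
      have h7 := hnorm i
      simp [dotProduct, this] at h7
    have hzero : ∑ u, ∑ v, (A u v * (y u * y v) + A u v * (b i u * b i v)) = 0 := by
      simp only [Finset.sum_add_distrib]
      rw [← quad_eq, ← quad_eq, h3, hself, hi]; ring
    have hnn : ∀ u v, 0 ≤ A u v * (y u * y v) + A u v * (b i u * b i v) := by
      intro u v
      rw [hy, ← hterm]
      linarith [neg_abs_le (A u v * (b i u * b i v))]
    apply hnb
    refine ⟨SimpleGraph.Coloring.mk (fun u => if 0 < b i u then (0 : Fin 2) else 1) ?_⟩
    intro u v huv hcol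
    have h8 := (Finset.sum_eq_zero_iff_of_nonneg (fun u _ => Finset.sum_nonneg
      (fun v _ => hnn u v))).1 hzero u (Finset.mem_univ u)
    have h9 := (Finset.sum_eq_zero_iff_of_nonneg (fun v _ => hnn u v)).1 h8 v (Finset.mem_univ v)
    have hA1 : A u v = 1 := by simp [hAdef, SimpleGraph.adjMatrix_apply, huv]
    rw [hA1, one_mul, one_mul] at h9
    have hyu : 0 < y u := abs_pos.2 (hpos u)
    have hyv : 0 < y v := abs_pos.2 (hpos v)
    have hlt : b i u * b i v < 0 := by nlinarith [mul_pos hyu hyv]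
    by_cases hu : 0 < b i u <;> by_cases hv : 0 < b i v
    · nlinarith [mul_pos hu hv]
    · simp [hu, hv] at hcol
    · simp [hu, hv] at hcol
    · nlinarith [mul_nonneg_of_nonpos_of_nonpos (not_lt.1 hu) (not_lt.1 hv)]
  have hmpos : 0 < m := by
    rcases ((abs_nonneg _).trans (habsle i0)).lt_or_eq with h | h
    · exact h
    · exact absurd (by rw [hi0, ← h, neg_zero]) (hneg i0)
  refine ⟨fun i => (1 ⬝ᵥ b i) ^ 2, l, m, rfl, hmpos, fun i => sq_nonneg _, ?_, ?_, ?_⟩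
  · intro k
    rw [walkCount_succ_eq, hquad]
    refine Finset.sum_congr rfl fun i _ => ?_
    rw [dotProduct_comm (b i)]; ring
  · intro i hi
    refine lt_of_le_of_ne (habsle i) fun h => ?_
    rcases (abs_eq hmpos.le).1 h with h | h
    · exact hi h
    · exact hneg i h
  · by_contra hcon
    push Not at hcon
    obtain ⟨-, h4⟩ := hext i0 (by rw [hi0, abs_of_pos hmpos])
    have h5 : (1 : V → ℝ) ⬝ᵥ |b i0| = 0 := by
      rw [← hsum]
      refine Finset.sum_eq_zero fun j _ => ?_
      by_cases hj : l j = m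
      · have : (1 : V → ℝ) ⬝ᵥ b j = 0 :=
          pow_eq_zero_iff (two_ne_zero) |>.1 (le_antisymm (hcon j hj) (sq_nonneg _))
        rw [this, zero_mul]
      · rw [dotProduct_comm (b j), h4 j hj, mul_zero]
    rw [one_dotProduct] at h5
    replace h5 := (Finset.sum_eq_zero_iff_of_nonneg
      (fun u _ => abs_nonneg (b i0 u) : ∀ u ∈ Finset.univ, 0 ≤ |b i0| u)).1 h5
    have h6 : ∀ u, b i0 u = 0 := fun u => abs_eq_zero.1 (h5 u (Finset.mem_univ u))
    have h7 := hnorm i0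
    simp [dotProduct, h6] at h7

/-- For a connected non-bipartite graph `G` and every fixed `q ≥ 0`, the ratio
`w_{l+q}(G)/w_{l−1}(G)` tends to `μ(G)^{q+1}` as `l → ∞`. -/
theorem walkCount_ratio_tendsto {V : Type*} [Fintype V] [DecidableEq V]
    (G : SimpleGraph V) [DecidableRel G.Adj]
    (hconn : G.Connected) (hnb : ¬ G.Colorable 2) (q : ℕ) :
    Filter.Tendsto (fun l : ℕ => (walkCount G (l + q) : ℝ) / (walkCount G (l - 1) : ℝ))
      Filter.atTop (nhds (adjSpectralRadius G ^ (q + 1))) := by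
  obtain ⟨c, r, m, hm, hmpos, hc, hw, hlt, i0, hi0, hci0⟩ := perron_info G hconn hnb
  rw [← hm]
  set C := ∑ i, c i * (if r i = m then 1 else 0) with hC
  have hCpos : 0 < C := by
    refine Finset.sum_pos' (fun i _ => mul_nonneg (hc i) (by split_ifs <;> norm_num))
      ⟨i0, Finset.mem_univ _, by simpa [hi0] using hci0⟩
  have hD : Filter.Tendsto (fun k : ℕ => (walkCount G (k + 1) : ℝ) / m ^ k) Filter.atTop
      (nhds C) := by
    have : (fun k : ℕ => (walkCount G (k + 1) : ℝ) / m ^ k)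
        = fun k => ∑ i, c i * (r i / m) ^ k := by
      funext k
      rw [hw, Finset.sum_div]
      refine Finset.sum_congr rfl fun i _ => ?_
      rw [div_pow]; ring
    rw [this]
    refine tendsto_finsetSum _ fun i _ => Filter.Tendsto.const_mul _ ?_
    split_ifs with h
    · rw [h, div_self hmpos.ne']
      exact tendsto_const_nhds.congr fun k => (one_pow k).symm
    · apply tendsto_pow_atTop_nhds_zero_of_abs_lt_one
      rw [abs_div, abs_of_pos hmpos, div_lt_one hmpos]
      exact hlt i h
  rw [← Filter.tendsto_add_atTop_iff_nat 2]
  have hlim := ((hD.comp (Filter.tendsto_add_atTop_nat (q + 1))).div hD hCpos.ne').mul_const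
    (m ^ (q + 1))
  rw [div_self hCpos.ne', one_mul] at hlim
  refine hlim.congr fun n => ?_
  have e1 : n + 2 + q = n + (q + 1) + 1 := by ring
  have e2 : n + 2 - 1 = n + 1 := rfl
  rw [e1, e2]
  simp only [Pi.div_apply, Function.comp_apply]
  rw [pow_add m n (q + 1)]
  have h1 : m ^ n ≠ 0 := (pow_pos hmpos _).ne'
  have h2 : m ^ (q + 1) ≠ 0 := (pow_pos hmpos _).ne'
  field_simp
end

section
/- Let G be a finite simple graph, let 2 ≤ s ≤ ω(G) and l ≥ 2 be integers. Then Σ_{u ∈ V(G)} ( k_s(u)·w_{l+1}(u) − k_{s+1}(u)·w_l(u) ) ≤ (s−1)·k_s(G)·w_l(G). -/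
open Finset

lemma walkCount_eq_sum {V : Type*} [Fintype V] (G : SimpleGraph V) (m : ℕ) :
    walkCount G (m + 1) = ∑ u : V, walkCountFrom G u (m + 1) := by
  classical
  unfold walkCount walkCountFrom
  rw [← Nat.card_sigma]
  refine Nat.card_congr
    { toFun := fun f => ⟨f.1 0, ⟨f.1, fun _ => rfl, f.2⟩⟩
      invFun := fun x => ⟨x.2.1, x.2.2.2⟩
      left_inv := fun f => rfl
      right_inv := ?_ }
  rintro ⟨u, f, h0, h⟩
  have : f 0 = u := h0 (Nat.succ_pos m)
  subst this
  rfl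

lemma walkCountFrom_succ {V : Type*} [Fintype V] (G : SimpleGraph V) [DecidableRel G.Adj]
    (u : V) (m : ℕ) :
    walkCountFrom G u (m + 2) = ∑ v : V, if G.Adj u v then walkCountFrom G v (m + 1) else 0 := by
  classical
  have key : ∀ v : V, (if G.Adj u v then walkCountFrom G v (m + 1) else 0) =
      Nat.card {f : Fin (m + 1) → V // G.Adj u v ∧ (∀ (h : 0 < m + 1), f ⟨0, h⟩ = v) ∧
        ∀ (i : ℕ) (h : i + 1 < m + 1), G.Adj (f ⟨i, Nat.lt_of_succ_lt h⟩) (f ⟨i + 1, h⟩)} := by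
    intro v
    by_cases hv : G.Adj u v
    · simp only [hv, if_true, true_and]; rfl
    · simp [hv]
  simp_rw [key]
  rw [← Nat.card_sigma]
  unfold walkCountFrom
  refine Nat.card_congr
    { toFun := fun f => ⟨f.1 1, ⟨fun i => f.1 i.succ, ?_, fun _ => rfl, ?_⟩⟩
      invFun := fun x => ⟨Fin.cons u x.2.1, fun _ => rfl, ?_⟩
      left_inv := ?_
      right_inv := ?_ }
  · have h := f.2.2 0 (by omega)
    have h0 := f.2.1 (by omega)
    rw [h0] at h
    exact h
  · intro i h
    exact f.2.2 (i + 1) (by omega)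
  · obtain ⟨v, g, hv, h0, h⟩ := x
    intro i hi
    cases i with
    | zero =>
      have : g ⟨0, by omega⟩ = v := h0 (by omega)
      change G.Adj u (g ⟨0, by omega⟩)
      rw [this]; exact hv
    | succ i => exact h i (by omega)
  · rintro ⟨f, h0, h⟩
    apply Subtype.ext
    funext i
    refine Fin.cases ?_ (fun j => ?_) i
    · exact (h0 (by omega)).symm
    · rfl
  · rintro ⟨v, g, hv, h0, h⟩
    have : g 0 = v := h0 (by omega)
    subst this
    rfl

lemma cliqueCountOn_succ_ge {V : Type*} [Fintype V] [DecidableEq V]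
    (G : SimpleGraph V) [DecidableRel G.Adj] (v : V) (s : ℕ) :
    ((G.cliqueFinset s).filter (fun t => ∀ u ∈ t, G.Adj v u)).card ≤ cliqueCountOn G v (s + 1) := by
  unfold cliqueCountOn
  refine Finset.card_le_card_of_injOn (fun t => insert v t) ?_ ?_
  · intro t ht
    simp only [Finset.coe_filter, Set.mem_setOf_eq, SimpleGraph.mem_cliqueFinset_iff] at ht ⊢
    exact ⟨ht.1.insert ht.2, Finset.mem_insert_self _ _⟩
  · intro t ht t' ht' hE
    simp only [Finset.coe_filter, Set.mem_setOf_eq] at ht ht'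
    have h1 : v ∉ t := fun h => G.loopless.irrefl v (ht.2 v h)
    have h2 : v ∉ t' := fun h => G.loopless.irrefl v (ht'.2 v h)
    have := congrArg (fun x => Finset.erase x v) hE
    simpa [Finset.erase_insert h1, Finset.erase_insert h2] using this

lemma sum_adj_cliqueCountOn_le {V : Type*} [Fintype V] [DecidableEq V]
    (G : SimpleGraph V) [DecidableRel G.Adj] (v : V) (s : ℕ) :
    (∑ u : V, if G.Adj u v then (cliqueCountOn G u s : ℤ) else 0) ≤
      ((s : ℤ) - 1) * cliqueCount G s + cliqueCountOn G v (s + 1) := by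
  have h1 : (∑ u : V, if G.Adj u v then (cliqueCountOn G u s : ℤ) else 0) =
      ∑ t ∈ G.cliqueFinset s, ((t.filter (fun u => G.Adj v u)).card : ℤ) := by
    simp only [cliqueCountOn, Finset.card_filter, Nat.cast_sum, Nat.cast_ite, Nat.cast_one,
      Nat.cast_zero]
    have : ∀ t : Finset V, (∑ u ∈ t, if G.Adj v u then (1 : ℤ) else 0) =
        ∑ u : V, if G.Adj u v then (if u ∈ t then 1 else 0) else 0 := by
      intro t
      rw [← Finset.sum_filter_add_sum_filter_not Finset.univ (fun u => u ∈ t)]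
      rw [Finset.sum_eq_zero (s := Finset.univ.filter (fun u => u ∉ t))]
      · rw [add_zero]
        refine Finset.sum_congr (by ext; simp) ?_
        intro u hu
        simp at hu
        simp [hu, G.adj_comm]
      · intro u hu
        simp at hu
        simp [hu]
    simp_rw [this]
    rw [Finset.sum_comm]
    refine Finset.sum_congr rfl fun u _ => ?_
    split_ifs <;> simp
  rw [h1]
  have h2 : ∀ t ∈ G.cliqueFinset s, ((t.filter (fun u => G.Adj v u)).card : ℤ) ≤
      ((s : ℤ) - 1) + if ∀ u ∈ t, G.Adj v u then 1 else 0 := by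
    intro t ht
    have hc : t.card = s := (SimpleGraph.mem_cliqueFinset_iff.mp ht).card_eq
    split_ifs with h
    · have := Finset.card_filter_le t (fun u => G.Adj v u)
      omega
    · have : (t.filter (fun u => G.Adj v u)).card < t.card := by
        apply Finset.card_lt_card
        rw [Finset.filter_ssubset]
        push Not at h
        exact h
      omega
  refine (Finset.sum_le_sum h2).trans ?_
  have h3 := cliqueCountOn_succ_ge G v s
  rw [Finset.card_filter] at h3
  have h4 : ((∑ t ∈ G.cliqueFinset s, if ∀ u ∈ t, G.Adj v u then 1 else 0 : ℕ) : ℤ) ≤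
    cliqueCountOn G v (s + 1) := by exact_mod_cast h3
  push_cast at h4
  rw [Finset.sum_add_distrib, Finset.sum_const, nsmul_eq_mul]
  unfold cliqueCount
  linarith

/-- **Nikiforov (2002).** For `2 ≤ s ≤ ω(G)` and `l ≥ 2`,
`∑_{u ∈ V(G)} (k_s(u)·w_{l+1}(u) − k_{s+1}(u)·w_l(u)) ≤ (s−1)·k_s(G)·w_l(G)`. -/
theorem sum_cliqueCountOn_walkCountFrom_le {V : Type*} [Fintype V] [DecidableEq V]
    (G : SimpleGraph V) [DecidableRel G.Adj] (s l : ℕ)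
    (hs2 : 2 ≤ s) (hsω : s ≤ G.cliqueNum) (hl : 2 ≤ l) :
    ∑ u : V, ((cliqueCountOn G u s : ℤ) * walkCountFrom G u (l + 1) -
        (cliqueCountOn G u (s + 1) : ℤ) * walkCountFrom G u l) ≤
      ((s : ℤ) - 1) * cliqueCount G s * walkCount G l := by
  obtain ⟨m, rfl⟩ : ∃ m, l = m + 1 := ⟨l - 1, by omega⟩
  rw [walkCount_eq_sum]
  have h1 : ∑ u : V, (cliqueCountOn G u s : ℤ) * walkCountFrom G u (m + 1 + 1) =
      ∑ v : V, (∑ u : V, if G.Adj u v then (cliqueCountOn G u s : ℤ) else 0) *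
        walkCountFrom G v (m + 1) := by
    simp_rw [walkCountFrom_succ]
    push_cast
    simp_rw [Finset.mul_sum, Finset.sum_mul]
    rw [Finset.sum_comm]
    refine Finset.sum_congr rfl fun v _ => Finset.sum_congr rfl fun u _ => ?_
    split_ifs <;> simp
  rw [Finset.sum_sub_distrib, h1, ← Finset.sum_sub_distrib]
  push_cast
  rw [Finset.mul_sum]
  refine Finset.sum_le_sum fun v _ => ?_
  have h := sum_adj_cliqueCountOn_le G v s
  have hw : (0 : ℤ) ≤ walkCountFrom G v (m + 1) := Int.natCast_nonneg _
  have := mul_le_mul_of_nonneg_right h hw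
  linarith
end
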